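/- arXiv:2307.08542 — 6 statements merged into one kernel-verified Lean document; each statement's English description precedes it below -/
import Mathlib

section
/- Let Ω be a finite nonempty set and I : (Ω → ℝ) → ℝ a functional defined on all real-valued functions on Ω. Then I is antimonotonically additive if and only if I is additive. -/
/-- Two functions `X, Y : Ω → ℝ` are comonotonic if
`(X ω - X ω') * (Y ω - Y ω') ≥ 0` for all `ω, ω'`. -/
def Comonotonic {Ω : Type*} (X Y : Ω → ℝ) : Prop :=
  ∀ ω ω' : Ω, (X ω - X ω') * (Y ω - Y ω') ≥ 0

/-- `X` and `Y` are antimonotonic if `X` and `-Y` are comonotonic. -/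
def Antimonotonic {Ω : Type*} (X Y : Ω → ℝ) : Prop :=
  Comonotonic X (-Y)

theorem Antimonotonic.of_nonneg_of_mul_eq_zero {Ω : Type*} {X Y : Ω → ℝ}
    (hX : ∀ ω, 0 ≤ X ω) (hY : ∀ ω, 0 ≤ Y ω) (h : ∀ ω, X ω * Y ω = 0) :
    Antimonotonic X Y := by
  intro ω ω'
  simp only [Pi.neg_apply]
  nlinarith [h ω, h ω', mul_nonneg (hX ω) (hY ω'), mul_nonneg (hX ω') (hY ω)]

theorem Antimonotonic.const_right {Ω : Type*} (X : Ω → ℝ) (c : ℝ) :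
    Antimonotonic X (fun _ => c) := by
  intro ω ω'
  simp

/-- An antimonotonically additive functional is additive on comonotonic pairs. -/
theorem Comonotonic.map_add {Ω : Type*} {I : (Ω → ℝ) → ℝ}
    (hI : ∀ X Y : Ω → ℝ, Antimonotonic X Y → I (X + Y) = I X + I Y)
    {X Y : Ω → ℝ} (h : Comonotonic X Y) : I (X + Y) = I X + I Y := by
  have h_zero : I 0 = 0 := by
    have := hI 0 0 (Antimonotonic.const_right 0 0)
    simpa using this
  have h_neg : I (Y + -Y) = I Y + I (-Y) := hI _ _ fun ω ω' => by
    simp only [neg_neg]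
    exact mul_self_nonneg _
  have h_sub : I (X + Y + -Y) = I (X + Y) + I (-Y) := hI _ _ fun ω ω' => by
    have := h ω ω'
    simp only [neg_neg, Pi.add_apply]
    nlinarith [sq_nonneg (Y ω - Y ω')]
  rw [add_neg_cancel, h_zero] at h_neg
  rw [add_neg_cancel_right] at h_sub
  linarith

theorem map_sum_single_of_nonneg {Ω : Type*} [DecidableEq Ω] {I : (Ω → ℝ) → ℝ}
    (hI : ∀ X Y : Ω → ℝ, Antimonotonic X Y → I (X + Y) = I X + I Y)
    {X : Ω → ℝ} (hX : ∀ ω, 0 ≤ X ω) (s : Finset Ω) :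
    I (∑ ω ∈ s, Pi.single ω (X ω)) = ∑ ω ∈ s, I (Pi.single ω (X ω)) := by
  induction s using Finset.induction_on with
  | empty => simpa using hI 0 0 (Antimonotonic.const_right 0 0)
  | insert a s ha ih =>
    rw [Finset.sum_insert ha, Finset.sum_insert ha, ← ih]
    have h_single : ∀ ω, 0 ≤ (Pi.single ω (X ω) : Ω → ℝ) := fun ω =>
      Pi.single_nonneg.2 (hX ω)
    refine hI _ _ (Antimonotonic.of_nonneg_of_mul_eq_zero (h_single a) ?_ ?_)
    · exact Finset.sum_nonneg fun ω _ => h_single ω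
    · intro ω
      rcases eq_or_ne ω a with rfl | hne
      · simp [Finset.sum_apply, Pi.single_apply, ha]
      · simp [hne]

theorem map_add_of_nonneg {Ω : Type*} [Fintype Ω] {I : (Ω → ℝ) → ℝ}
    (hI : ∀ X Y : Ω → ℝ, Antimonotonic X Y → I (X + Y) = I X + I Y)
    {X Y : Ω → ℝ} (hX : ∀ ω, 0 ≤ X ω) (hY : ∀ ω, 0 ≤ Y ω) :
    I (X + Y) = I X + I Y := by
  classical
  have h_sum : ∀ Z : Ω → ℝ, (∀ ω, 0 ≤ Z ω) → I Z = ∑ ω, I (Pi.single ω (Z ω)) := by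
    intro Z hZ
    rw [← map_sum_single_of_nonneg hI hZ, Finset.univ_sum_single]
  rw [h_sum X hX, h_sum Y hY, h_sum (X + Y) fun ω => add_nonneg (hX ω) (hY ω),
    ← Finset.sum_add_distrib]
  refine Finset.sum_congr rfl fun ω _ => ?_
  rw [Pi.add_apply, Pi.single_add]
  refine Comonotonic.map_add hI fun ω₁ ω₂ => ?_
  have := mul_nonneg (hX ω) (hY ω)
  by_cases h₁ : ω₁ = ω <;> by_cases h₂ : ω₂ = ω <;> simp [h₁, h₂, this]

/-- On a finite nonempty state space, antimonotonic additivity of a functional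
`I : (Ω → ℝ) → ℝ` is equivalent to additivity. -/
theorem am_additive_iff_additive {Ω : Type*} [Fintype Ω] [Nonempty Ω]
    (I : (Ω → ℝ) → ℝ) :
    (∀ X Y : Ω → ℝ, Antimonotonic X Y → I (X + Y) = I X + I Y) ↔
    (∀ X Y : Ω → ℝ, I (X + Y) = I X + I Y) := by
  refine ⟨fun hI X Y => ?_, fun hI X Y _ => hI X Y⟩
  have h_shift : ∀ (Z : Ω → ℝ) (c : ℝ), I (Z + fun _ => c) = I Z + I (fun _ => c) :=
    fun Z c => hI _ _ (Antimonotonic.const_right Z c)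
  have h_bound : ∀ Z : Ω → ℝ, ∃ c : ℝ, ∀ ω, 0 ≤ (Z + fun _ => c : Ω → ℝ) ω := by
    intro Z
    obtain ⟨ω₀, h⟩ := Finite.exists_min Z
    exact ⟨-Z ω₀, fun ω => by simpa using h ω⟩
  obtain ⟨c, hc⟩ := h_bound X
  obtain ⟨d, hd⟩ := h_bound Y
  have h := map_add_of_nonneg hI hc hd
  have h_const := h_shift (fun _ => c) d
  have h_total := h_shift (X + Y) (c + d)
  change I (X + Y + ((fun _ => c) + fun _ => d)) = _ + I ((fun _ => c) + fun _ => d) at h_total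
  rw [add_add_add_comm, h_total, h_shift X, h_shift Y, h_const] at h
  linarith
end

section
/- Let Ω be a finite nonempty set and I : (Ω → ℝ) → ℝ a functional that is antimonotonically additive and continuous at at least one point (with respect to the product topology on Ω → ℝ, equivalently the sup-norm topology). Then I is linear (i.e., I(X+Y) = I(X)+I(Y) and I(αX) = αI(X) for all X, Y : Ω → ℝ and all α ∈ ℝ) and continuous everywhere. -/
section AmAdditive

variable {Ω : Type*} {I : (Ω → ℝ) → ℝ}

/-- Antimonotonic additivity, with the sign condition written out pointwise. -/
theorem map_add_of_forall_mul_nonpos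
    (hadd : ∀ X Y : Ω → ℝ, Antimonotonic X Y → I (X + Y) = I X + I Y) {X Y : Ω → ℝ}
    (h : ∀ ω ω', (X ω - X ω') * (Y ω - Y ω') ≤ 0) : I (X + Y) = I X + I Y := by
  refine hadd X Y fun ω ω' => ?_
  have := h ω ω'
  simp only [Pi.neg_apply]
  linarith

theorem map_zero_of_am_additive
    (hadd : ∀ X Y : Ω → ℝ, Antimonotonic X Y → I (X + Y) = I X + I Y) : I 0 = 0 := by
  have h := map_add_of_forall_mul_nonpos hadd (X := 0) (Y := 0) (by simp)
  rw [add_zero] at h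
  linarith

/-- An antimonotonically additive functional is also comonotonically additive. -/
theorem Comonotonic.map_add_of_am_additive
    (hadd : ∀ X Y : Ω → ℝ, Antimonotonic X Y → I (X + Y) = I X + I Y) {X Y : Ω → ℝ}
    (h : Comonotonic X Y) : I (X + Y) = I X + I Y := by
  have hneg : I (Y + -Y) = I Y + I (-Y) := map_add_of_forall_mul_nonpos hadd fun ω ω' => by
    simp only [Pi.neg_apply]
    nlinarith [sq_nonneg (Y ω - Y ω')]
  have hsub : I (X + Y + -Y) = I (X + Y) + I (-Y) :=
    map_add_of_forall_mul_nonpos hadd fun ω ω' => by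
      have := h ω ω'
      simp only [Pi.neg_apply, Pi.add_apply]
      nlinarith [sq_nonneg (Y ω - Y ω')]
  rw [add_neg_cancel, map_zero_of_am_additive hadd] at hneg
  rw [add_neg_cancel_right] at hsub
  linarith

variable [DecidableEq Ω]

theorem map_single_add_of_am_additive
    (hadd : ∀ X Y : Ω → ℝ, Antimonotonic X Y → I (X + Y) = I X + I Y) (ω : Ω) (s t : ℝ) :
    I (Pi.single ω (s + t)) = I (Pi.single ω s) + I (Pi.single ω t) := by
  rw [Pi.single_add]
  rcases le_total 0 (s * t) with h | h
  · refine Comonotonic.map_add_of_am_additive hadd fun a b => ?_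
    by_cases ha : a = ω <;> by_cases hb : b = ω <;> simp [ha, hb, h]
  · refine map_add_of_forall_mul_nonpos hadd fun a b => ?_
    by_cases ha : a = ω <;> by_cases hb : b = ω <;> simp [ha, hb, h]

/-- Multiples of indicators decompose into atoms. -/
theorem map_indicator_of_am_additive
    (hadd : ∀ X Y : Ω → ℝ, Antimonotonic X Y → I (X + Y) = I X + I Y) (c : ℝ) (A : Finset Ω) :
    I (fun ω => if ω ∈ A then c else 0) = ∑ ω ∈ A, I (Pi.single ω c) := by
  induction A using Finset.induction_on with
  | empty => simpa [Pi.zero_def] using map_zero_of_am_additive hadd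
  | insert a A ha ih =>
    rw [Finset.sum_insert ha, ← ih, ← map_add_of_forall_mul_nonpos hadd]
    · congr 1
      ext ω
      by_cases h : ω = a
      · subst h
        simp [ha]
      · simp [h]
    · intro ω ω'
      by_cases h : ω = a <;> by_cases h' : ω' = a <;> by_cases k : ω ∈ A <;>
        by_cases k' : ω' ∈ A <;> simp_all [mul_self_nonneg]

variable [Fintype Ω]

theorem map_eq_sum_single_of_nonneg
    (hadd : ∀ X Y : Ω → ℝ, Antimonotonic X Y → I (X + Y) = I X + I Y) (X : Ω → ℝ)
    (hX : ∀ ω, 0 ≤ X ω) : I X = ∑ ω, I (Pi.single ω (X ω)) := by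
  induction hn : (Finset.univ.filter fun ω => X ω ≠ 0).card using Nat.strong_induction_on
    generalizing X with
  | _ n ih =>
    set A := Finset.univ.filter fun ω => X ω ≠ 0 with hA
    have memA (ω : Ω) : ω ∈ A ↔ X ω ≠ 0 := by simp [hA]
    rcases A.eq_empty_or_nonempty with he | hne
    · have hX0 : X = 0 := by
        ext ω
        by_contra h
        simpa [he] using (memA ω).2 h
      simp [hX0, map_zero_of_am_additive hadd]
    obtain ⟨a, ha, hmin⟩ := A.exists_min_image X hne
    set U : Ω → ℝ := fun ω => if ω ∈ A then X a else 0 with hU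
    set Y : Ω → ℝ := fun ω => X ω - U ω with hY
    have hXUY : X = U + Y := by ext ω; simp [hY]
    have hYA (ω : Ω) (h : ω ∉ A) : Y ω = 0 := by
      have : X ω = 0 := by simpa [memA] using h
      simp [hY, hU, h, this]
    have hY0 (ω : Ω) : 0 ≤ Y ω := by
      by_cases h : ω ∈ A
      · simpa [hY, hU, h] using hmin ω h
      · exact (hYA ω h).ge
    have hlt : (Finset.univ.filter fun ω => Y ω ≠ 0).card < n := by
      rw [← hn]
      refine Finset.card_lt_card (Finset.ssubset_iff_of_subset ?_ |>.2 ⟨a, ha, ?_⟩)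
      · intro ω hω
        by_contra h
        simp [hYA ω h] at hω
      · simp [hY, hU, ha]
    have hco : Comonotonic U Y := by
      intro ω ω'
      by_cases h : ω ∈ A <;> by_cases h' : ω' ∈ A <;> simp only [hU, h, h', if_true, if_false]
      · simp
      · rw [hYA ω' h']
        simpa using mul_nonneg (hX a) (hY0 ω)
      · rw [hYA ω h]
        simpa using mul_nonneg (hX a) (hY0 ω')
      · simp
    have hUsum : I U = ∑ ω, I (Pi.single ω (U ω)) := by
      rw [hU, map_indicator_of_am_additive hadd, ← Finset.sum_subset A.subset_univ]
      · exact Finset.sum_congr rfl fun ω h => by simp [h]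
      · intro ω _ h
        simp [h, map_zero_of_am_additive hadd]
    calc I X = I U + I Y := by
          conv_lhs => rw [hXUY]
          exact hco.map_add_of_am_additive hadd
      _ = ∑ ω, (I (Pi.single ω (U ω)) + I (Pi.single ω (Y ω))) := by
          rw [ih _ hlt Y hY0 rfl, hUsum, Finset.sum_add_distrib]
      _ = ∑ ω, I (Pi.single ω (X ω)) := by
          refine Finset.sum_congr rfl fun ω _ => ?_
          rw [← map_single_add_of_am_additive hadd, hXUY, Pi.add_apply]

/-- An antimonotonically additive functional on a finite space is a sum over atoms. -/
theorem map_eq_sum_single_of_am_additive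
    (hadd : ∀ X Y : Ω → ℝ, Antimonotonic X Y → I (X + Y) = I X + I Y) (X : Ω → ℝ) :
    I X = ∑ ω, I (Pi.single ω (X ω)) := by
  set c : ℝ := ∑ ω, |X ω|
  have hc (ω : Ω) : |X ω| ≤ c :=
    Finset.single_le_sum (f := fun ω => |X ω|) (fun _ _ => abs_nonneg _) (Finset.mem_univ ω)
  have hconst := map_eq_sum_single_of_nonneg hadd (fun _ => c)
    (fun ω => (abs_nonneg _).trans (hc ω))
  have hshift := map_eq_sum_single_of_nonneg hadd (X + fun _ => c) fun ω => by
    have := neg_abs_le (X ω)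
    have := hc ω
    simp only [Pi.add_apply]
    linarith
  rw [map_add_of_forall_mul_nonpos hadd (by simp)] at hshift
  simp only [Pi.add_apply, map_single_add_of_am_additive hadd, Finset.sum_add_distrib] at hshift
  linarith

end AmAdditive

/-- On a finite nonempty state space, an antimonotonically additive functional
`I : (Ω → ℝ) → ℝ` that is continuous at (at least) one point is linear and
continuous everywhere. -/
theorem am_additive_continuousAt_linear {Ω : Type*} [Fintype Ω] [Nonempty Ω]
    (I : (Ω → ℝ) → ℝ)
    (hadd : ∀ X Y : Ω → ℝ, Antimonotonic X Y → I (X + Y) = I X + I Y)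
    (hcont : ∃ X₀ : Ω → ℝ, ContinuousAt I X₀) :
    (∀ X Y : Ω → ℝ, I (X + Y) = I X + I Y) ∧
    (∀ (α : ℝ) (X : Ω → ℝ), I (α • X) = α * I X) ∧
    Continuous I := by
  classical
  have hlin (X Y : Ω → ℝ) : I (X + Y) = I X + I Y := by
    rw [map_eq_sum_single_of_am_additive hadd (X + Y), map_eq_sum_single_of_am_additive hadd X,
      map_eq_sum_single_of_am_additive hadd Y, ← Finset.sum_add_distrib]
    exact Finset.sum_congr rfl fun ω _ => map_single_add_of_am_additive hadd ω _ _
  let f : (Ω → ℝ) →+ ℝ := AddMonoidHom.mk' I hlin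
  obtain ⟨X₀, hX₀⟩ := hcont
  have hf : Continuous f := by
    refine continuous_of_continuousAt_zero f ?_
    have hshift : ContinuousAt (fun X => I (X + X₀) - I X₀) 0 := by
      refine ContinuousAt.sub (ContinuousAt.comp (f := fun X => X + X₀) ?_ ?_) continuousAt_const
      · simpa using hX₀
      · fun_prop
    refine hshift.congr (Filter.Eventually.of_forall fun X => ?_)
    simp [f, hlin]
  exact ⟨hlin, fun α X => map_real_smul f hf α X, hf⟩
end

section
/- Let Ω be any nonempty set and I : (Ω → ℝ) → ℝ an antimonotonically additive functional on all real-valued functions on Ω. Then I(0) = 0, I(−X) = −I(X) for every X : Ω → ℝ, and I is comonotonically additive: I(X+Y) = I(X) + I(Y) whenever X and Y are comonotonic. -/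
/-- An antimonotonically additive functional `I : (Ω → ℝ) → ℝ` on all real-valued
functions on a nonempty set `Ω` satisfies `I 0 = 0`, `I (-X) = - I X`, and is
comonotonically additive. -/
theorem am_additive_implies_comonotonic_additive {Ω : Type*} [Nonempty Ω]
    (I : (Ω → ℝ) → ℝ)
    (hadd : ∀ X Y : Ω → ℝ, Antimonotonic X Y → I (X + Y) = I X + I Y) :
    I 0 = 0 ∧
    (∀ X : Ω → ℝ, I (-X) = - I X) ∧
    (∀ X Y : Ω → ℝ, Comonotonic X Y → I (X + Y) = I X + I Y) := by
  have hzero : I 0 = 0 := by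
    have h := hadd 0 0 (fun _ _ => by simp)
    rw [add_zero] at h
    linarith
  have hneg : ∀ X : Ω → ℝ, I (-X) = - I X := by
    intro X
    have h := hadd X (-X) (fun ω ω' => by
      rw [neg_neg]
      exact mul_self_nonneg _)
    rw [add_neg_cancel, hzero] at h
    linarith
  refine ⟨hzero, hneg, fun X Y hXY => ?_⟩
  have h := hadd (X + Y) (-Y) (fun ω ω' => by
    have h₁ := hXY ω ω'
    have h₂ := mul_self_nonneg (Y ω - Y ω')
    simp only [neg_neg, Pi.add_apply]
    linarith)
  rw [add_neg_cancel_right, hneg] at h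
  linarith
end

section
/- Let (Ω, 𝓕) be a measurable space and let B denote the set of bounded measurable functions X : Ω → ℝ, equipped with the supremum metric. Let I : B → ℝ be continuous (with respect to the supremum metric). Then I is antimonotonically additive if and only if I is linear, i.e., I(X+Y) = I(X)+I(Y) and I(αX) = αI(X) for all X, Y ∈ B and all α ∈ ℝ. -/
/-- The set of bounded measurable real-valued functions on `Ω`. -/
def BddMeas (Ω : Type*) [MeasurableSpace Ω] : Set (Ω → ℝ) :=
  {X | Measurable X ∧ ∃ M : ℝ, ∀ ω, |X ω| ≤ M}

namespace BddMeas

variable {Ω : Type*} [MeasurableSpace Ω] {X Y : Ω → ℝ} {I : (Ω → ℝ) → ℝ}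

lemma add_mem (hX : X ∈ BddMeas Ω) (hY : Y ∈ BddMeas Ω) : X + Y ∈ BddMeas Ω := by
  obtain ⟨hX, M, hM⟩ := hX
  obtain ⟨hY, N, hN⟩ := hY
  exact ⟨hX.add hY, M + N, fun ω => (abs_add_le _ _).trans (add_le_add (hM ω) (hN ω))⟩

lemma smul_mem (a : ℝ) (hX : X ∈ BddMeas Ω) : a • X ∈ BddMeas Ω := by
  obtain ⟨hX, M, hM⟩ := hX
  refine ⟨hX.const_smul a, |a| * M, fun ω => ?_⟩
  simpa [abs_mul] using mul_le_mul_of_nonneg_left (hM ω) (abs_nonneg a)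

lemma neg_mem (hX : X ∈ BddMeas Ω) : -X ∈ BddMeas Ω := by
  simpa using smul_mem (-1) hX

lemma const_mem (c : ℝ) : (fun _ => c : Ω → ℝ) ∈ BddMeas Ω :=
  ⟨measurable_const, |c|, fun _ => le_rfl⟩

lemma indicator_mem {A : Set Ω} (hA : MeasurableSet A) (hX : X ∈ BddMeas Ω) :
    A.indicator X ∈ BddMeas Ω := by
  obtain ⟨hX, M, hM⟩ := hX
  refine ⟨hX.indicator hA, M, fun ω => ?_⟩
  by_cases h : ω ∈ A
  · simpa [h] using hM ω
  · simpa [h] using (abs_nonneg _).trans (hM ω)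

/-- Bounded measurable functions are uniformly approximated by finitely-valued ones, obtained by
rounding down to a multiple of `δ`. -/
lemma exists_finite_range_approx (hX : X ∈ BddMeas Ω) (hX0 : ∀ ω, 0 ≤ X ω) {δ : ℝ} (hδ : 0 < δ) :
    ∃ Z ∈ BddMeas Ω, (∀ ω, 0 ≤ Z ω) ∧ (Set.range Z).Finite ∧ ∀ ω, |X ω - Z ω| ≤ δ := by
  obtain ⟨hXm, M, hM⟩ := hX
  have hfin : (Set.range fun ω => δ * (⌊X ω / δ⌋ : ℝ)).Finite := by
    refine ((Set.finite_Icc (0 : ℤ) ⌊M / δ⌋).image fun n : ℤ => δ * (n : ℝ)).subset ?_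
    rintro _ ⟨ω, rfl⟩
    refine ⟨⌊X ω / δ⌋, ⟨Int.floor_nonneg.2 (div_nonneg (hX0 ω) hδ.le), Int.floor_mono ?_⟩, rfl⟩
    exact div_le_div_of_nonneg_right ((le_abs_self _).trans (hM ω)) hδ.le
  have hnonneg : ∀ ω, 0 ≤ δ * (⌊X ω / δ⌋ : ℝ) := fun ω =>
    mul_nonneg hδ.le (Int.cast_nonneg (Int.floor_nonneg.2 (div_nonneg (hX0 ω) hδ.le)))
  have hle : ∀ ω, δ * (⌊X ω / δ⌋ : ℝ) ≤ X ω := fun ω => by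
    rw [mul_comm, ← le_div_iff₀ hδ]
    exact Int.floor_le _
  refine ⟨fun ω => δ * (⌊X ω / δ⌋ : ℝ), ⟨?_, M, fun ω => ?_⟩, hnonneg, hfin, fun ω => ?_⟩
  · exact ((measurable_of_countable (fun n : ℤ => (n : ℝ))).comp
      (hXm.div_const δ).floor).const_mul δ
  · rw [abs_of_nonneg (hnonneg ω)]
    exact (hle ω).trans ((le_abs_self _).trans (hM ω))
  · rw [abs_of_nonneg (sub_nonneg.2 (hle ω))]
    have h := (div_lt_iff₀ hδ).1 (Int.lt_floor_add_one (X ω / δ))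
    linarith

lemma map_zero_of_am
    (hI : ∀ X ∈ BddMeas Ω, ∀ Y ∈ BddMeas Ω, Antimonotonic X Y → I (X + Y) = I X + I Y) :
    I 0 = 0 := by
  have h := hI 0 (const_mem 0) 0 (const_mem 0) (fun _ _ => by simp)
  simpa using h

lemma map_neg_of_am
    (hI : ∀ X ∈ BddMeas Ω, ∀ Y ∈ BddMeas Ω, Antimonotonic X Y → I (X + Y) = I X + I Y)
    (hX : X ∈ BddMeas Ω) : I (-X) = -I X := by
  have h := hI X hX (-X) (neg_mem hX)
    (fun ω ω' => by simpa using mul_self_nonneg (X ω - X ω'))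
  rw [add_neg_cancel, map_zero_of_am hI] at h
  linarith

/-- An antimonotonically additive functional is comonotonically additive. -/
lemma map_add_of_comonotonic
    (hI : ∀ X ∈ BddMeas Ω, ∀ Y ∈ BddMeas Ω, Antimonotonic X Y → I (X + Y) = I X + I Y)
    (hX : X ∈ BddMeas Ω) (hY : Y ∈ BddMeas Ω) (h : Comonotonic X Y) :
    I (X + Y) = I X + I Y := by
  have key := hI (X + Y) (add_mem hX hY) (-Y) (neg_mem hY) fun ω ω' => by
    have := h ω ω'
    simp only [Pi.add_apply, neg_neg]
    nlinarith [sq_nonneg (Y ω - Y ω')]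
  rw [add_neg_cancel_right, map_neg_of_am hI hY] at key
  linarith

lemma map_indicator_union
    (hI : ∀ X ∈ BddMeas Ω, ∀ Y ∈ BddMeas Ω, Antimonotonic X Y → I (X + Y) = I X + I Y)
    (hX : X ∈ BddMeas Ω) (hX0 : ∀ ω, 0 ≤ X ω) {A B : Set Ω} (hA : MeasurableSet A)
    (hB : MeasurableSet B) (hAB : Disjoint A B) :
    I ((A ∪ B).indicator X) = I (A.indicator X) + I (B.indicator X) := by
  rw [Set.indicator_union_of_disjoint hAB]
  refine hI _ (indicator_mem hA hX) _ (indicator_mem hB hX) fun ω ω' => ?_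
  have hd : ∀ ω, A.indicator X ω * B.indicator X ω = 0 := fun ω => by
    by_cases h : ω ∈ A
    · simp [Set.disjoint_left.1 hAB h]
    · simp [h]
  have hA0 : ∀ ω, 0 ≤ A.indicator X ω := fun ω => Set.indicator_nonneg (fun ω _ => hX0 ω) ω
  have hB0 : ∀ ω, 0 ≤ B.indicator X ω := fun ω => Set.indicator_nonneg (fun ω _ => hX0 ω) ω
  have h₁ := mul_nonneg (hA0 ω) (hB0 ω')
  have h₂ := mul_nonneg (hA0 ω') (hB0 ω)
  simp only [Pi.neg_apply]
  nlinarith [hd ω, hd ω']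

lemma map_add_of_finite_range
    (hI : ∀ X ∈ BddMeas Ω, ∀ Y ∈ BddMeas Ω, Antimonotonic X Y → I (X + Y) = I X + I Y)
    (hX : X ∈ BddMeas Ω) (hY : Y ∈ BddMeas Ω) (hX0 : ∀ ω, 0 ≤ X ω) (hY0 : ∀ ω, 0 ≤ Y ω)
    (hXfin : (Set.range X).Finite) (hYfin : (Set.range Y).Finite) :
    I (X + Y) = I X + I Y := by
  classical
  set h : Ω → ℝ × ℝ := fun ω => (X ω, Y ω)
  have hmeas : Measurable h := hX.1.prodMk hY.1
  have key : ∀ s : Finset (ℝ × ℝ), I ((h ⁻¹' s).indicator (X + Y)) =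
      I ((h ⁻¹' s).indicator X) + I ((h ⁻¹' s).indicator Y) := by
    intro s
    induction s using Finset.induction_on with
    | empty =>
      have h0 : (I fun _ => 0) = 0 := map_zero_of_am hI
      simp [h0]
    | insert p s hp ih =>
      have hA : MeasurableSet (h ⁻¹' {p}) := hmeas (measurableSet_singleton p)
      have hB : MeasurableSet (h ⁻¹' (s : Set (ℝ × ℝ))) := hmeas s.measurableSet
      have hdisj : Disjoint (h ⁻¹' {p}) (h ⁻¹' (s : Set (ℝ × ℝ))) :=
        Disjoint.preimage h (by simpa using hp)
      have hXp : ∀ ω, (h ⁻¹' {p}).indicator X ω = p.1 * (h ⁻¹' {p}).indicator 1 ω := fun ω => by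
        by_cases hω : h ω = p
        · simp [Set.indicator, hω, ← congrArg Prod.fst hω, h]
        · simp [Set.indicator, hω]
      have hYp : ∀ ω, (h ⁻¹' {p}).indicator Y ω = p.2 * (h ⁻¹' {p}).indicator 1 ω := fun ω => by
        by_cases hω : h ω = p
        · simp [Set.indicator, hω, ← congrArg Prod.snd hω, h]
        · simp [Set.indicator, hω]
      have hcell : I ((h ⁻¹' {p}).indicator (X + Y)) =
          I ((h ⁻¹' {p}).indicator X) + I ((h ⁻¹' {p}).indicator Y) := by
        rw [Set.indicator_add']
        refine map_add_of_comonotonic hI (indicator_mem hA hX) (indicator_mem hA hY) ?_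
        intro ω ω'
        by_cases hne : ∃ ω₀, h ω₀ = p
        · obtain ⟨ω₀, rfl⟩ := hne
          rw [hXp, hXp, hYp, hYp, ← mul_sub, ← mul_sub, mul_mul_mul_comm]
          exact mul_nonneg (mul_nonneg (hX0 ω₀) (hY0 ω₀)) (mul_self_nonneg _)
        · push Not at hne
          simp [hne]
      rw [Finset.coe_insert, Set.insert_eq, Set.preimage_union,
        map_indicator_union hI (add_mem hX hY) (fun ω => add_nonneg (hX0 ω) (hY0 ω)) hA hB hdisj,
        map_indicator_union hI hX hX0 hA hB hdisj, map_indicator_union hI hY hY0 hA hB hdisj,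
        hcell, ih]
      ring
  have huniv : h ⁻¹' ((hXfin.prod hYfin).toFinset : Set (ℝ × ℝ)) = Set.univ := by
    ext ω
    simp [h]
  have hfinal := key (hXfin.prod hYfin).toFinset
  rwa [huniv, Set.indicator_univ, Set.indicator_univ, Set.indicator_univ] at hfinal

lemma map_add_of_nonneg
    (hcont : ∀ X ∈ BddMeas Ω, ∀ ε > (0:ℝ), ∃ δ > (0:ℝ), ∀ Y ∈ BddMeas Ω,
      (∀ ω, |X ω - Y ω| ≤ δ) → |I X - I Y| ≤ ε)
    (hI : ∀ X ∈ BddMeas Ω, ∀ Y ∈ BddMeas Ω, Antimonotonic X Y → I (X + Y) = I X + I Y)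
    (hX : X ∈ BddMeas Ω) (hY : Y ∈ BddMeas Ω) (hX0 : ∀ ω, 0 ≤ X ω) (hY0 : ∀ ω, 0 ≤ Y ω) :
    I (X + Y) = I X + I Y := by
  refine eq_of_abs_sub_le_all fun ε hε => ?_
  obtain ⟨δ₁, hδ₁, h₁⟩ := hcont X hX (ε / 3) (by positivity)
  obtain ⟨δ₂, hδ₂, h₂⟩ := hcont Y hY (ε / 3) (by positivity)
  obtain ⟨δ₃, hδ₃, h₃⟩ := hcont (X + Y) (add_mem hX hY) (ε / 3) (by positivity)
  obtain ⟨Z, hZ, hZ0, hZfin, hXZ⟩ :=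
    exists_finite_range_approx hX hX0 (δ := min δ₁ (δ₃ / 2)) (by positivity)
  obtain ⟨W, hW, hW0, hWfin, hYW⟩ :=
    exists_finite_range_approx hY hY0 (δ := min δ₂ (δ₃ / 2)) (by positivity)
  have e₁ := h₁ Z hZ fun ω => (hXZ ω).trans (min_le_left _ _)
  have e₂ := h₂ W hW fun ω => (hYW ω).trans (min_le_left _ _)
  have e₃ := h₃ (Z + W) (add_mem hZ hW) fun ω => by
    have a := (hXZ ω).trans (min_le_right _ _)
    have b := (hYW ω).trans (min_le_right _ _)
    rw [Pi.add_apply, Pi.add_apply, add_sub_add_comm]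
    exact (abs_add_le _ _).trans (by linarith)
  rw [map_add_of_finite_range hI hZ hW hZ0 hW0 hZfin hWfin] at e₃
  rw [abs_le] at *
  constructor <;> linarith

lemma map_add_of_am
    (hcont : ∀ X ∈ BddMeas Ω, ∀ ε > (0:ℝ), ∃ δ > (0:ℝ), ∀ Y ∈ BddMeas Ω,
      (∀ ω, |X ω - Y ω| ≤ δ) → |I X - I Y| ≤ ε)
    (hI : ∀ X ∈ BddMeas Ω, ∀ Y ∈ BddMeas Ω, Antimonotonic X Y → I (X + Y) = I X + I Y)
    (hX : X ∈ BddMeas Ω) (hY : Y ∈ BddMeas Ω) : I (X + Y) = I X + I Y := by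
  obtain ⟨M, hM⟩ := hX.2
  obtain ⟨N, hN⟩ := hY.2
  have hc : ∀ c : ℝ, ∀ Z ∈ BddMeas Ω, I (Z + fun _ => c) = I Z + I fun _ => c := fun c Z hZ =>
    hI Z hZ _ (const_mem c) fun _ _ => by simp
  have h := map_add_of_nonneg hcont hI (add_mem hX (const_mem M)) (add_mem hY (const_mem N))
    (fun ω => by simpa using neg_le_iff_add_nonneg.1 (abs_le.1 (hM ω)).1)
    (fun ω => by simpa using neg_le_iff_add_nonneg.1 (abs_le.1 (hN ω)).1)
  rw [add_add_add_comm, ← add_assoc, hc N _ (add_mem (add_mem hX hY) (const_mem M)),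
    hc M _ (add_mem hX hY), hc M X hX, hc N Y hY] at h
  linarith

lemma map_smul_of_map_add
    (hcont : ∀ X ∈ BddMeas Ω, ∀ ε > (0:ℝ), ∃ δ > (0:ℝ), ∀ Y ∈ BddMeas Ω,
      (∀ ω, |X ω - Y ω| ≤ δ) → |I X - I Y| ≤ ε)
    (hI : ∀ X ∈ BddMeas Ω, ∀ Y ∈ BddMeas Ω, I (X + Y) = I X + I Y)
    (a : ℝ) (hX : X ∈ BddMeas Ω) : I (a • X) = a * I X := by
  let f : ℝ →+ ℝ := AddMonoidHom.mk' (fun t => I (t • X)) fun s t => by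
    rw [add_smul, hI _ (smul_mem s hX) _ (smul_mem t hX)]
  have hf : Continuous f := by
    obtain ⟨M, hM⟩ := hX.2
    refine Metric.continuous_iff'.2 fun t ε hε => ?_
    obtain ⟨δ, hδ, h⟩ := hcont (t • X) (smul_mem t hX) (ε / 2) (by positivity)
    have hη : 0 < δ / (|M| + 1) := by positivity
    filter_upwards [Metric.ball_mem_nhds t hη] with s hs
    rw [dist_comm, Real.dist_eq]
    refine (h (s • X) (smul_mem s hX) fun ω => ?_).trans_lt (half_lt_self hε)
    rw [Metric.mem_ball, dist_comm, Real.dist_eq] at hs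
    rw [Pi.smul_apply, Pi.smul_apply, ← sub_smul, smul_eq_mul, abs_mul]
    calc |t - s| * |X ω| ≤ δ / (|M| + 1) * (|M| + 1) :=
          mul_le_mul hs.le (by linarith [hM ω, le_abs_self M]) (abs_nonneg _) hη.le
      _ = δ := div_mul_cancel₀ _ (by positivity)
  simpa [f] using map_real_smul f hf a 1

end BddMeas

/-- For a functional `I` on the bounded measurable functions that is continuous
with respect to the supremum metric, antimonotonic additivity is equivalent to
linearity. -/
theorem am_additive_iff_linear_of_continuous {Ω : Type*} [MeasurableSpace Ω]
    (I : (Ω → ℝ) → ℝ)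
    (hcont : ∀ X ∈ BddMeas Ω, ∀ ε > (0:ℝ), ∃ δ > (0:ℝ), ∀ Y ∈ BddMeas Ω,
      (∀ ω, |X ω - Y ω| ≤ δ) → |I X - I Y| ≤ ε) :
    (∀ X ∈ BddMeas Ω, ∀ Y ∈ BddMeas Ω, Antimonotonic X Y → I (X + Y) = I X + I Y) ↔
    ((∀ X ∈ BddMeas Ω, ∀ Y ∈ BddMeas Ω, I (X + Y) = I X + I Y) ∧
     (∀ (α : ℝ), ∀ X ∈ BddMeas Ω, I (α • X) = α * I X)) := by
  constructor
  · intro hI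
    have hadd : ∀ X ∈ BddMeas Ω, ∀ Y ∈ BddMeas Ω, I (X + Y) = I X + I Y :=
      fun X hX Y hY => BddMeas.map_add_of_am hcont hI hX hY
    exact ⟨hadd, fun a X hX => BddMeas.map_smul_of_map_add hcont hadd a hX⟩
  · rintro ⟨hadd, -⟩ X hX Y hY -
    exact hadd X hX Y hY
end

section
/- Let Ω be a finite nonempty set and ≽ a binary relation on the functions Ω → ℝ (acts) whose restriction to constant acts agrees with the natural order ≥ on ℝ. Then the following are equivalent: (1) there exists a probability vector p : Ω → ℝ (p(ω) ≥ 0 for all ω, Σ_ω p(ω) = 1) such that for all acts X, Y: X ≽ Y if and only if Σ_ω p(ω)X(ω) ≥ Σ_ω p(ω)Y(ω); (2) every act X has a certainty equivalent (a real x with the constant act x indifferent to X), ≽ is a weak order (complete and transitive), ≽ is monotone (X(ω) ≥ Y(ω) for all ω implies X ≽ Y), and ≽ is antimonotonically additive: whenever X and Z are antimonotonic acts and X ∼ x for a constant x, then X + Z ∼ x + Z. -/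
theorem antimonotonic_iff {Ω : Type*} {X Y : Ω → ℝ} :
    Antimonotonic X Y ↔ ∀ ω ω', (X ω - X ω') * (Y ω - Y ω') ≤ 0 := by
  refine forall₂_congr fun ω ω' => ?_
  rw [ge_iff_le, ← neg_nonneg, Pi.neg_apply, Pi.neg_apply]
  ring_nf

theorem antimonotonic_smul_smul {Ω : Type*} (X : Ω → ℝ) {s t : ℝ} (h : s * t ≤ 0) :
    Antimonotonic (s • X) (t • X) := by
  refine antimonotonic_iff.2 fun ω ω' => ?_
  simp only [Pi.smul_apply, smul_eq_mul]
  have := mul_nonpos_of_nonpos_of_nonneg h (sq_nonneg (X ω - X ω'))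
  linarith

theorem antimonotonic_of_nonneg_of_mul_eq_zero {Ω : Type*} {X Y : Ω → ℝ} (hX : 0 ≤ X)
    (hY : 0 ≤ Y) (h : X * Y = 0) : Antimonotonic X Y := by
  refine antimonotonic_iff.2 fun ω ω' => ?_
  have h1 : X ω * Y ω = 0 := congrFun h ω
  have h2 : X ω' * Y ω' = 0 := congrFun h ω'
  have h3 := mul_nonneg (hX ω) (hY ω')
  have h4 := mul_nonneg (hX ω') (hY ω)
  linarith

section Functional

variable {Ω : Type*} {I : (Ω → ℝ) → ℝ}

theorem map_add_smul_of_antimonotonic_add (h0 : I 0 = 0)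
    (hadd : ∀ X Y, Antimonotonic X Y → I (X + Y) = I X + I Y) (X : Ω → ℝ) (s t : ℝ) :
    I ((s + t) • X) = I (s • X) + I (t • X) := by
  have opp : ∀ s t : ℝ, s * t ≤ 0 → I ((s + t) • X) = I (s • X) + I (t • X) := fun s t h => by
    rw [add_smul, hadd _ _ (antimonotonic_smul_smul X h)]
  have odd : I (t • X) + I (-t • X) = 0 := by
    rw [← opp t (-t) (by nlinarith [sq_nonneg t]), add_neg_cancel, zero_smul, h0]
  rcases le_total (s * t) 0 with h | h
  · exact opp s t h
  · have := opp (s + t) (-t) (by nlinarith [sq_nonneg t])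
    rw [add_neg_cancel_right] at this
    linarith

theorem map_smul_of_antimonotonic_add (hc : ∀ a : ℝ, I (Function.const Ω a) = a)
    (hmono : Monotone I) (hadd : ∀ X Y, Antimonotonic X Y → I (X + Y) = I X + I Y)
    {X : Ω → ℝ} (hX : 0 ≤ X) (hX1 : X ≤ 1) (t : ℝ) : I (t • X) = t * I X := by
  let f : ℝ →+ ℝ := AddMonoidHom.mk' (fun t => I (t • X))
    (map_add_smul_of_antimonotonic_add (hc 0) hadd X)
  have hf : Continuous f := by
    refine AddMonoidHomClass.continuous_of_bound f 1 fun t => ?_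
    have hb : ∀ ω, |t * X ω| ≤ |t| := fun ω => by
      rw [abs_mul, abs_of_nonneg (hX ω)]
      exact mul_le_of_le_one_right (abs_nonneg t) (hX1 ω)
    rw [one_mul, Real.norm_eq_abs, Real.norm_eq_abs, abs_le]
    constructor
    · rw [← hc (-|t|)]
      exact hmono fun ω => (abs_le.1 (hb ω)).1
    · rw [← hc |t|]
      exact hmono fun ω => (abs_le.1 (hb ω)).2
  have h := map_real_smul f hf t 1
  simpa [f] using h

theorem eq_sum_of_antimonotonic_add [Fintype Ω] [DecidableEq Ω]
    (hc : ∀ a : ℝ, I (Function.const Ω a) = a)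
    (hmono : Monotone I) (hadd : ∀ X Y, Antimonotonic X Y → I (X + Y) = I X + I Y)
    (X : Ω → ℝ) : I X = ∑ ω, I (Pi.single ω 1) * X ω := by
  have single : ∀ (ω : Ω) (t : ℝ), I (Pi.single ω t) = I (Pi.single ω 1) * t := fun ω t => by
    have h0 : (0 : Ω → ℝ) ≤ Pi.single ω 1 := Pi.single_nonneg.2 zero_le_one
    have h1 : (Pi.single ω 1 : Ω → ℝ) ≤ 1 := fun ω' => by
      by_cases h : ω' = ω
      · subst h; simp
      · simp [h]
    have := map_smul_of_antimonotonic_add hc hmono hadd h0 h1 t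
    rw [← Pi.single_smul, smul_eq_mul, mul_one] at this
    rw [this, mul_comm]
  have nonneg : ∀ X : Ω → ℝ, 0 ≤ X → I X = ∑ ω, I (Pi.single ω 1) * X ω := fun X hX => by
    have partial_sum : ∀ s : Finset Ω,
        I (∑ ω ∈ s, Pi.single ω (X ω)) = ∑ ω ∈ s, I (Pi.single ω 1) * X ω := fun s => by
      induction s using Finset.induction_on with
      | empty => simpa using hc 0
      | insert a s ha ih =>
        rw [Finset.sum_insert ha, Finset.sum_insert ha, ← ih, ← single]
        refine hadd _ _ (antimonotonic_of_nonneg_of_mul_eq_zero (Pi.single_nonneg.2 (hX a))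
          (Finset.sum_nonneg fun ω _ => Pi.single_nonneg.2 (hX ω)) ?_)
        rw [Finset.mul_sum]
        refine Finset.sum_eq_zero fun ω hω => ?_
        have hne : a ≠ ω := fun h => ha (h ▸ hω)
        ext ω'
        by_cases h : ω' = a
        · subst h; simp [hne]
        · simp [h]
    rw [← partial_sum, Finset.univ_sum_single]
  have hconst_anti : ∀ (X : Ω → ℝ) (a : ℝ), Antimonotonic X (Function.const Ω a) :=
    fun X a => antimonotonic_iff.2 fun ω ω' => by simp
  obtain ⟨c, hc0, hcX⟩ : ∃ c : ℝ, 0 ≤ c ∧ ∀ ω, -X ω ≤ c :=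
    ⟨∑ ω, |X ω|, Finset.sum_nonneg fun ω _ => abs_nonneg _, fun ω =>
      (neg_le_abs _).trans
        (Finset.single_le_sum (f := fun ω => |X ω|) (fun ω _ => abs_nonneg _)
          (Finset.mem_univ ω))⟩
  have h1 := nonneg (X + Function.const Ω c) fun ω => by
    have := hcX ω
    simp only [Pi.zero_apply, Pi.add_apply, Function.const_apply]
    linarith
  have h2 := nonneg (Function.const Ω c) fun ω => hc0
  rw [hadd _ _ (hconst_anti X c), h2] at h1
  simp only [Pi.add_apply, mul_add, Finset.sum_add_distrib] at h1
  linarith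

end Functional

/-- de Finetti's bookmaking theorem with antimonotonic additivity: a preference
relation on acts agreeing with `≥` on constants maximizes expected value for a
(subjective) probability vector iff certainty equivalents exist and the relation
is a weak order, monotone, and antimonotonically additive. -/
theorem am_deFinetti {Ω : Type*} [Fintype Ω] [Nonempty Ω]
    (R : (Ω → ℝ) → (Ω → ℝ) → Prop)
    (hconst : ∀ a b : ℝ, R (Function.const Ω a) (Function.const Ω b) ↔ a ≥ b) :
    (∃ p : Ω → ℝ, (∀ ω, 0 ≤ p ω) ∧ (∑ ω, p ω) = 1 ∧
      (∀ X Y : Ω → ℝ, R X Y ↔ (∑ ω, p ω * X ω) ≥ ∑ ω, p ω * Y ω)) ↔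
    ((∀ X : Ω → ℝ, ∃ x : ℝ,
        R X (Function.const Ω x) ∧ R (Function.const Ω x) X) ∧
     (∀ X Y : Ω → ℝ, R X Y ∨ R Y X) ∧
     (∀ X Y Z : Ω → ℝ, R X Y → R Y Z → R X Z) ∧
     (∀ X Y : Ω → ℝ, (∀ ω, X ω ≥ Y ω) → R X Y) ∧
     (∀ X Z : Ω → ℝ, Antimonotonic X Z → ∀ x : ℝ,
        (R X (Function.const Ω x) ∧ R (Function.const Ω x) X) →
        (R (X + Z) (Function.const Ω x + Z) ∧
         R (Function.const Ω x + Z) (X + Z)))) := by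
  classical
  constructor
  · rintro ⟨p, hp, hp1, hR⟩
    have hE : ∀ x : ℝ, ∑ ω, p ω * Function.const Ω x ω = x := fun x => by
      simp [← Finset.sum_mul, hp1]
    refine ⟨fun X => ⟨∑ ω, p ω * X ω, ?_, ?_⟩, fun X Y => ?_, fun X Y Z hXY hYZ => ?_,
      fun X Y h => ?_, fun X Z _ x hx => ?_⟩
    · rw [hR, hE]
    · rw [hR, hE]
    · rw [hR, hR]
      exact le_total _ _
    · rw [hR] at *
      exact ge_trans hXY hYZ
    · rw [hR]
      exact Finset.sum_le_sum fun ω _ => mul_le_mul_of_nonneg_left (h ω) (hp ω)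
    · rw [hR, hR] at *
      simpa only [Pi.add_apply, mul_add, Finset.sum_add_distrib, ge_iff_le,
        add_le_add_iff_right] using hx
  · rintro ⟨hce, -, htrans, hmono, hadd⟩
    choose I hI using hce
    have hR : ∀ X Y, R X Y ↔ I X ≥ I Y := fun X Y => by
      rw [← hconst]
      exact ⟨fun h => htrans _ _ _ (hI X).2 (htrans _ _ _ h (hI Y).1),
        fun h => htrans _ _ _ (hI X).1 (htrans _ _ _ h (hI Y).2)⟩
    have hIu : ∀ X x, R X (Function.const Ω x) → R (Function.const Ω x) X → I X = x :=
      fun X x h1 h2 => le_antisymm ((hconst _ _).1 (htrans _ _ _ h2 (hI X).1))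
        ((hconst _ _).1 (htrans _ _ _ (hI X).2 h1))
    have hIc : ∀ a : ℝ, I (Function.const Ω a) = a := fun a =>
      hIu _ _ ((hconst a a).2 le_rfl) ((hconst a a).2 le_rfl)
    have hImono : Monotone I := fun X Y h => (hR Y X).1 (hmono Y X h)
    have hItrans : ∀ (X : Ω → ℝ) (a : ℝ), I (Function.const Ω a + X) = a + I X := fun X a => by
      have h := hadd X (Function.const Ω a) (antimonotonic_iff.2 fun ω ω' => by simp) _ (hI X)
      rw [add_comm, add_comm a]
      exact hIu _ _ h.1 h.2
    have hIadd : ∀ X Y, Antimonotonic X Y → I (X + Y) = I X + I Y := fun X Y h => by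
      have h' := hadd X Y h _ (hI X)
      rw [← hItrans]
      exact le_antisymm ((hR _ _).1 h'.2) ((hR _ _).1 h'.1)
    have hsum := eq_sum_of_antimonotonic_add hIc hImono hIadd
    refine ⟨fun ω => I (Pi.single ω 1), fun ω => ?_, ?_, fun X Y => ?_⟩
    · have h0 : (0 : Ω → ℝ) ≤ Pi.single ω 1 := Pi.single_nonneg.2 zero_le_one
      exact (hIc 0).symm.le.trans (hImono h0)
    · have h := hsum (Function.const Ω 1)
      rw [hIc] at h
      simpa using h.symm
    · rw [hR, hsum X, hsum Y]
end

section
/- Let Ω be a finite nonempty set, V a real vector space, C ⊆ V a nonempty convex set (the outcome set), and ≽ a binary relation on the acts Ω → C. The following three statements are equivalent: (i) ≽ is a weak order (complete and transitive), monotone (if the constant act X(ω) ≽ the constant act Y(ω) for every ω, then X ≽ Y), mixture continuous ({α ∈ [0,1] : αX + (1−α)Z ≽ Y} and {α ∈ [0,1] : Y ≽ αX + (1−α)Z} are closed for all acts X, Y, Z, where mixtures of acts are taken statewise), and satisfies strong independence: for all acts X, Z, every outcome x ∈ C, and every α ∈ (0,1), X ∼ x implies αX + (1−α)Z ∼ αx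 + (1−α)Z; (ii) ≽ is a weak order, monotone, mixture continuous, and satisfies antimonotonic independence: the implication of strong independence is imposed only when X and Z are antimonotonic; (iii) there exist a probability vector p : Ω → ℝ (p ≥ 0, Σ_ω p(ω) = 1) and an affine function U : C → ℝ such that for all acts X, Y: X ≽ Y if and only if Σ_ω p(ω)U(X(ω)) ≥ Σ_ω p(ω)U(Y(ω)). -/
section AA

variable {Ω : Type*} {V : Type*} [AddCommGroup V] [Module ℝ V]

/-- An act is a map from states into the (convex) outcome set `C`. -/
def IsAct (C : Set V) (X : Ω → V) : Prop := ∀ ω, X ω ∈ C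

/-- Strict preference between outcomes, via the preference on constant acts. -/
def OutcomeStrictPref (R : (Ω → V) → (Ω → V) → Prop) (x y : V) : Prop :=
  R (Function.const Ω x) (Function.const Ω y) ∧
    ¬ R (Function.const Ω y) (Function.const Ω x)

/-- Two acts are antimonotonic if there are no states `ω, ω'` with
`X ω ≻ X ω'` and `Z ω ≻ Z ω'`. -/
def AntimonotonicActs (R : (Ω → V) → (Ω → V) → Prop) (X Z : Ω → V) : Prop :=
  ¬ ∃ ω ω' : Ω, OutcomeStrictPref R (X ω) (X ω') ∧ OutcomeStrictPref R (Z ω) (Z ω')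

/-- Weak order: completeness and transitivity on acts. -/
def WeakOrderActs (C : Set V) (R : (Ω → V) → (Ω → V) → Prop) : Prop :=
  (∀ X Y, IsAct C X → IsAct C Y → (R X Y ∨ R Y X)) ∧
  (∀ X Y Z, IsAct C X → IsAct C Y → IsAct C Z → R X Y → R Y Z → R X Z)

/-- Monotonicity: statewise preference between outcomes implies preference. -/
def MonotoneActs (C : Set V) (R : (Ω → V) → (Ω → V) → Prop) : Prop :=
  ∀ X Y, IsAct C X → IsAct C Y →
    (∀ ω, R (Function.const Ω (X ω)) (Function.const Ω (Y ω))) → R X Y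

/-- Mixture continuity of the preference relation. -/
def MixtureContinuousActs (C : Set V) (R : (Ω → V) → (Ω → V) → Prop) : Prop :=
  ∀ X Y Z, IsAct C X → IsAct C Y → IsAct C Z →
    IsClosed {α : ℝ | α ∈ Set.Icc (0:ℝ) 1 ∧ R (α • X + (1 - α) • Z) Y} ∧
    IsClosed {α : ℝ | α ∈ Set.Icc (0:ℝ) 1 ∧ R Y (α • X + (1 - α) • Z)}

/-- Strong independence (stated with a constant act on one side). -/
def StrongIndependence (C : Set V) (R : (Ω → V) → (Ω → V) → Prop) : Prop :=
  ∀ X Z, IsAct C X → IsAct C Z → ∀ x ∈ C, ∀ α ∈ Set.Ioo (0:ℝ) 1,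
    (R X (Function.const Ω x) ∧ R (Function.const Ω x) X) →
    (R (α • X + (1 - α) • Z) (α • Function.const Ω x + (1 - α) • Z) ∧
     R (α • Function.const Ω x + (1 - α) • Z) (α • X + (1 - α) • Z))

/-- Antimonotonic independence: strong independence restricted to
antimonotonic pairs `X, Z`. -/
def AmIndependence (C : Set V) (R : (Ω → V) → (Ω → V) → Prop) : Prop :=
  ∀ X Z, IsAct C X → IsAct C Z → AntimonotonicActs R X Z →
    ∀ x ∈ C, ∀ α ∈ Set.Ioo (0:ℝ) 1,
    (R X (Function.const Ω x) ∧ R (Function.const Ω x) X) →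
    (R (α • X + (1 - α) • Z) (α • Function.const Ω x + (1 - α) • Z) ∧
     R (α • Function.const Ω x + (1 - α) • Z) (α • X + (1 - α) • Z))

/-- Subjective expected utility representation with affine utility. -/
def SEURepresentation [Fintype Ω] (C : Set V) (R : (Ω → V) → (Ω → V) → Prop) : Prop :=
  ∃ p : Ω → ℝ, (∀ ω, 0 ≤ p ω) ∧ (∑ ω, p ω) = 1 ∧
    ∃ U : V → ℝ,
      (∀ x ∈ C, ∀ y ∈ C, ∀ α ∈ Set.Ioo (0:ℝ) 1,
        U (α • x + (1 - α) • y) = α * U x + (1 - α) * U y) ∧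
      (∀ X Y, IsAct C X → IsAct C Y →
        (R X Y ↔ (∑ ω, p ω * U (X ω)) ≥ ∑ ω, p ω * U (Y ω)))

end AA

/-- The mixture `α x + (1 - α) y`. -/
def mix {V : Type*} [AddCommGroup V] [Module ℝ V] (α : ℝ) (x y : V) : V :=
  α • x + (1 - α) • y

/-- A continuous weak order on a convex set whose indifference relation is preserved by mixing. -/
structure MixturePref {V : Type*} [AddCommGroup V] [Module ℝ V] (C : Set V)
    (r : V → V → Prop) : Prop where
  convex : Convex ℝ C
  total : ∀ x ∈ C, ∀ y ∈ C, r x y ∨ r y x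
  trans : ∀ x ∈ C, ∀ y ∈ C, ∀ z ∈ C, r x y → r y z → r x z
  closed_upper : ∀ x ∈ C, ∀ z ∈ C, ∀ y ∈ C,
    IsClosed {α : ℝ | α ∈ Set.Icc (0 : ℝ) 1 ∧ r (mix α x z) y}
  closed_lower : ∀ x ∈ C, ∀ z ∈ C, ∀ y ∈ C,
    IsClosed {α : ℝ | α ∈ Set.Icc (0 : ℝ) 1 ∧ r y (mix α x z)}
  indep : ∀ x ∈ C, ∀ y ∈ C, ∀ z ∈ C, ∀ α ∈ Set.Ioo (0 : ℝ) 1,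
    r x y → r y x → r (mix α x z) (mix α y z)

section Mix

variable {V : Type*} [AddCommGroup V] [Module ℝ V]

@[simp] theorem mix_one (x y : V) : mix 1 x y = x := by simp [mix]

@[simp] theorem mix_zero (x y : V) : mix 0 x y = y := by simp [mix]

theorem mix_self (α : ℝ) (x : V) : mix α x x = x := by unfold mix; module

theorem mix_swap (α : ℝ) (x y : V) : mix (1 - α) y x = mix α x y := by unfold mix; module

theorem mix_mix_left (α s : ℝ) (x y : V) : mix α (mix s x y) y = mix (α * s) x y := by
  unfold mix; module

theorem mix_mix_left' (α s : ℝ) (x y : V) :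
    mix α (mix s x y) x = mix (α * s + (1 - α)) x y := by
  unfold mix; module

theorem mix_mix_right (α s : ℝ) (x y : V) :
    mix α x (mix s x y) = mix (α + (1 - α) * s) x y := by
  unfold mix; module

theorem mix_mix_mix (α s t : ℝ) (x y : V) :
    mix α (mix s x y) (mix t x y) = mix (α * s + (1 - α) * t) x y := by
  unfold mix; module

theorem mix_comm (α β : ℝ) (x y z : V) :
    mix α (mix β x y) z = mix β (mix α x z) (mix α y z) := by
  unfold mix; module

theorem mix_mem {C : Set V} (hC : Convex ℝ C) {x y : V} (hx : x ∈ C) (hy : y ∈ C) {α : ℝ}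
    (hα : α ∈ Set.Icc (0 : ℝ) 1) : mix α x y ∈ C :=
  hC hx hy hα.1 (by linarith [hα.2]) (by ring)

/-- The intermediate value property of a complete relation with closed sections on a segment. -/
theorem exists_mix_indiff {D : Set V} {r : V → V → Prop} (hD : Convex ℝ D)
    (total : ∀ x ∈ D, ∀ y ∈ D, r x y ∨ r y x) {x y z : V}
    (hx : x ∈ D) (hy : y ∈ D) (hz : z ∈ D)
    (hup : IsClosed {α : ℝ | α ∈ Set.Icc (0 : ℝ) 1 ∧ r (mix α x z) y})
    (hlow : IsClosed {α : ℝ | α ∈ Set.Icc (0 : ℝ) 1 ∧ r y (mix α x z)})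
    (hxy : r x y) (hyz : r y z) :
    ∃ α ∈ Set.Icc (0 : ℝ) 1, r (mix α x z) y ∧ r y (mix α x z) := by
  have hpre := isPreconnected_closed_iff.1 (isPreconnected_Icc (a := (0 : ℝ)) (b := 1))
    _ _ hup hlow
    (fun α hα => (total _ (mix_mem hD hx hz hα) y hy).imp (fun h => ⟨hα, h⟩) (fun h => ⟨hα, h⟩))
    ⟨1, by simp, by simp, by simpa using hxy⟩ ⟨0, by simp, by simp, by simpa using hyz⟩
  obtain ⟨α, hα, h1, h2⟩ := hpre
  exact ⟨α, hα, h1.2, h2.2⟩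

end Mix

namespace MixturePref

variable {V : Type*} [AddCommGroup V] [Module ℝ V] {C : Set V} {r : V → V → Prop}

theorem refl (h : MixturePref C r) {x : V} (hx : x ∈ C) : r x x :=
  (h.total x hx x hx).elim id id

theorem exists_mix (h : MixturePref C r) {x y z : V} (hx : x ∈ C) (hy : y ∈ C) (hz : z ∈ C)
    (hxy : r x y) (hyz : r y z) :
    ∃ α ∈ Set.Icc (0 : ℝ) 1, r (mix α x z) y ∧ r y (mix α x z) :=
  exists_mix_indiff h.convex h.total hx hy hz (h.closed_upper x hx z hz y hy)
    (h.closed_lower x hx z hz y hy) hxy hyz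

/-- Two indifferent points of a segment are indifferent to the endpoint. -/
theorem indiff_endpoint (h : MixturePref C r) {x y : V} (hx : x ∈ C) (hy : y ∈ C) {s t : ℝ}
    (hs : 0 ≤ s) (hst : s < t) (ht : t ≤ 1) (h1 : r (mix s x y) (mix t x y))
    (h2 : r (mix t x y) (mix s x y)) : r x (mix s x y) ∧ r (mix s x y) x := by
  have hw : mix s x y ∈ C := mix_mem h.convex hx hy ⟨hs, by linarith⟩
  have hclosed := (h.closed_upper x hx y hy _ hw).inter (h.closed_lower x hx y hy _ hw)
  have hcompact := (isCompact_Icc (a := (0 : ℝ)) (b := 1)).of_isClosed_subset hclosed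
    (fun α hα => hα.1.1)
  obtain ⟨b, ⟨⟨hb, hb1⟩, -, hb2⟩, hmax⟩ := hcompact.exists_isGreatest
    ⟨t, ⟨⟨⟨by linarith, ht⟩, h2⟩, ⟨⟨by linarith, ht⟩, h1⟩⟩⟩
  have htb : t ≤ b := hmax ⟨⟨⟨by linarith, ht⟩, h2⟩, ⟨⟨by linarith, ht⟩, h1⟩⟩
  rcases hb.2.eq_or_lt with rfl | hlt
  · simpa using And.intro hb1 hb2
  exfalso
  have hs1 : 0 < 1 - s := by linarith
  obtain ⟨α, hα⟩ : ∃ α, α = (1 - b) / (1 - s) := ⟨_, rfl⟩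
  have hαs : α * s + (1 - α) = b := by rw [hα]; field_simp; ring
  have hα0 : 0 < α := by rw [hα]; exact div_pos (by linarith) hs1
  have hα1 : α < 1 := by rw [hα, div_lt_one hs1]; linarith
  have hbC : mix b x y ∈ C := mix_mem h.convex hx hy hb
  have hc : α * b + (1 - α) ∈ Set.Icc (0 : ℝ) 1 := ⟨by nlinarith [hb.1], by nlinarith⟩
  have hcC := mix_mem h.convex hx hy hc
  have e1 := h.indep _ hw _ hbC x hx α ⟨hα0, hα1⟩ hb2 hb1
  have e2 := h.indep _ hbC _ hw x hx α ⟨hα0, hα1⟩ hb1 hb2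
  rw [mix_mix_left', mix_mix_left', hαs] at e1 e2
  have := hmax ⟨⟨hc, h.trans _ hcC _ hbC _ hw e2 hb1⟩, ⟨hc, h.trans _ hw _ hbC _ hcC hb2 e1⟩⟩
  nlinarith

theorem not_indiff_of_lt (h : MixturePref C r) {x y : V} (hx : x ∈ C) (hy : y ∈ C)
    (hyx : ¬ r y x) {s t : ℝ} (hs : 0 ≤ s) (hst : s < t) (ht : t ≤ 1)
    (h1 : r (mix s x y) (mix t x y)) (h2 : r (mix t x y) (mix s x y)) : False := by
  have hsC : mix s x y ∈ C := mix_mem h.convex hx hy ⟨hs, by linarith⟩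
  have htC : mix t x y ∈ C := mix_mem h.convex hx hy ⟨by linarith, ht⟩
  have a := h.indiff_endpoint hx hy hs hst ht h1 h2
  have b := h.indiff_endpoint hy hx (s := 1 - t) (t := 1 - s) (by linarith) (by linarith)
    (by linarith) (by simpa only [mix_swap] using h2) (by simpa only [mix_swap] using h1)
  rw [mix_swap] at b
  exact hyx (h.trans _ hy _ htC _ hx b.1 (h.trans _ htC _ hsC _ hx h2 a.2))

theorem not_mix_endpoint (h : MixturePref C r) {x y : V} (hx : x ∈ C) (hy : y ∈ C)
    (hyx : ¬ r y x) {w : ℝ} (hw : w ∈ Set.Ico (0 : ℝ) 1) : ¬ r (mix w x y) x := by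
  intro hr
  have hxy := (h.total x hx y hy).resolve_right hyx
  obtain ⟨a, ha, h1, h2⟩ := h.exists_mix (mix_mem h.convex hx hy ⟨hw.1, hw.2.le⟩) hx hy hr hxy
  rw [mix_mix_left] at h1 h2
  exact h.not_indiff_of_lt hx hy hyx (mul_nonneg ha.1 hw.1)
    (by nlinarith [ha.1, ha.2, hw.1, hw.2]) le_rfl (by simpa using h1) (by simpa using h2)

theorem not_endpoint_mix (h : MixturePref C r) {x y : V} (hx : x ∈ C) (hy : y ∈ C)
    (hyx : ¬ r y x) {w : ℝ} (hw : w ∈ Set.Ioc (0 : ℝ) 1) : ¬ r y (mix w x y) := by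
  intro hr
  have hxy := (h.total x hx y hy).resolve_right hyx
  obtain ⟨a, ha, h1, h2⟩ := h.exists_mix hx hy (mix_mem h.convex hx hy ⟨hw.1.le, hw.2⟩) hxy hr
  rw [mix_mix_right] at h1 h2
  exact h.not_indiff_of_lt hx hy hyx (s := 0) (t := a + (1 - a) * w) le_rfl
    (by nlinarith [ha.1, ha.2, hw.1, hw.2]) (by nlinarith [ha.1, ha.2, hw.1, hw.2])
    (by simpa using h2) (by simpa using h1)

/-- Preference is strictly increasing along a segment. -/
theorem not_mix_of_lt (h : MixturePref C r) {x y : V} (hx : x ∈ C) (hy : y ∈ C)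
    (hyx : ¬ r y x) {s t : ℝ} (hs : 0 ≤ s) (hst : s < t) (ht : t ≤ 1) :
    ¬ r (mix s x y) (mix t x y) := by
  have ht0 : 0 < t := by linarith
  have htC : mix t x y ∈ C := mix_mem h.convex hx hy ⟨ht0.le, ht⟩
  have := h.not_mix_endpoint htC hy (h.not_endpoint_mix hx hy hyx ⟨ht0, ht⟩) (w := s / t)
    ⟨by positivity, (div_lt_one ht0).2 hst⟩
  rwa [mix_mix_left, div_mul_cancel₀ _ ht0.ne'] at this

theorem mix_iff_le (h : MixturePref C r) {x y : V} (hx : x ∈ C) (hy : y ∈ C)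
    (hyx : ¬ r y x) {s t : ℝ} (hs : s ∈ Set.Icc (0 : ℝ) 1) (ht : t ∈ Set.Icc (0 : ℝ) 1) :
    r (mix s x y) (mix t x y) ↔ t ≤ s := by
  refine ⟨fun hr => not_lt.1 fun hlt => h.not_mix_of_lt hx hy hyx hs.1 hlt ht.2 hr, fun hle => ?_⟩
  rcases hle.eq_or_lt with rfl | hlt
  · exact h.refl (mix_mem h.convex hx hy hs)
  · exact (h.total _ (mix_mem h.convex hx hy hs) _ (mix_mem h.convex hx hy ht)).resolve_right
      (h.not_mix_of_lt hx hy hyx ht.1 hlt hs.2)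

theorem strict_indep (h : MixturePref C r) {x y z : V} (hx : x ∈ C) (hy : y ∈ C) (hz : z ∈ C)
    (hyx : ¬ r y x) {α : ℝ} (hα : α ∈ Set.Ioo (0 : ℝ) 1) :
    ¬ r (mix α y z) (mix α x z) := by
  intro hr
  have hxy := (h.total x hx y hy).resolve_right hyx
  have hα' : α ∈ Set.Icc (0 : ℝ) 1 := ⟨hα.1.le, hα.2.le⟩
  have hyz := mix_mem h.convex hy hz hα'
  have hxz := mix_mem h.convex hx hz hα'
  by_cases hzx : r z x
  · obtain ⟨s, hs, h1, h2⟩ := h.exists_mix hz hx hy hzx hxy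
    have hs0 : 0 < s := by
      rcases hs.1.eq_or_lt with rfl | h0
      · exact absurd (by simpa using h1) hyx
      · exact h0
    have hyz' : ¬ r y z := fun h' => hyx (h.trans _ hy _ hz _ hx h' hzx)
    have hm := mix_mem h.convex hz hy hs
    have e := h.indep _ hx _ hm z hz α hα h2 h1
    have := h.trans _ hyz _ hxz _ (mix_mem h.convex hm hz hα') hr e
    rw [mix_mix_left', ← mix_swap] at this
    exact h.not_mix_of_lt hz hy hyz' (by linarith [hα.2])
      (by nlinarith [hα.1]) (by nlinarith [hα.1, hs.2]) this
  by_cases hyz0 : r y z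
  · obtain ⟨s, hs, h1, h2⟩ := h.exists_mix hx hy hz hxy hyz0
    have hs1 : s < 1 := by
      rcases hs.2.eq_or_lt with rfl | h0
      · exact absurd (by simpa using h2) hyx
      · exact h0
    have hm := mix_mem h.convex hx hz hs
    have e := h.indep _ hm _ hy z hz α hα h1 h2
    have := h.trans _ (mix_mem h.convex hm hz hα') _ hyz _ hxz e hr
    rw [mix_mix_left] at this
    exact h.not_mix_of_lt hx hz hzx (mul_nonneg hα.1.le hs.1) (by nlinarith [hα.1]) hα.2.le this
  · have hzy := (h.total z hz y hy).resolve_right hyz0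
    have e1 : r z (mix α y z) := by
      have := (h.mix_iff_le hz hy hyz0 (s := 1) (t := 1 - α) (by simp)
        ⟨by linarith [hα.2], by linarith [hα.1]⟩).2 (by linarith [hα.1])
      simpa [mix_swap] using this
    exact h.not_endpoint_mix hx hz hzx ⟨hα.1, hα.2.le⟩ (h.trans _ hz _ hyz _ hxz e1 hr)

theorem mix_iff (h : MixturePref C r) {x y z : V} (hx : x ∈ C) (hy : y ∈ C) (hz : z ∈ C)
    {α : ℝ} (hα : α ∈ Set.Ioo (0 : ℝ) 1) : r (mix α x z) (mix α y z) ↔ r x y := by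
  have hα' : α ∈ Set.Icc (0 : ℝ) 1 := ⟨hα.1.le, hα.2.le⟩
  refine ⟨fun hr => by_contra fun hn => h.strict_indep hy hx hz hn hα hr, fun hr => ?_⟩
  by_cases hyx : r y x
  · exact h.indep _ hx _ hy _ hz α hα hr hyx
  · exact (h.total _ (mix_mem h.convex hx hz hα') _ (mix_mem h.convex hy hz hα')).resolve_right
      (h.strict_indep hx hy hz hyx hα)

/-- The outcome `x`, shrunk by the factor `α` towards the midpoint of `b` and `a`, is indifferent
to the point of the segment from `a` to `b` that makes `u` the utility of `x` in the scale with
`a` at `0` and `b` at `1`. -/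
def IsScaledValue (r : V → V → Prop) (b a x : V) (u α : ℝ) : Prop :=
  α ∈ Set.Ioo (0 : ℝ) 1 ∧ α * u + (1 - α) * (1 / 2) ∈ Set.Icc (0 : ℝ) 1 ∧
    r (mix α x (mix (1 / 2) b a)) (mix (α * u + (1 - α) * (1 / 2)) b a) ∧
    r (mix (α * u + (1 - α) * (1 / 2)) b a) (mix α x (mix (1 / 2) b a))

theorem half_mem : (1 / 2 : ℝ) ∈ Set.Icc (0 : ℝ) 1 := by constructor <;> norm_num

theorem IsScaledValue.mul (h : MixturePref C r) {b a x : V} (hb : b ∈ C) (ha : a ∈ C)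
    (hx : x ∈ C) {u α β : ℝ} (hG : IsScaledValue r b a x u α) (hβ : β ∈ Set.Ioo (0 : ℝ) 1) :
    IsScaledValue r b a x u (β * α) := by
  obtain ⟨hα, ht, h1, h2⟩ := hG
  have hm := mix_mem h.convex hb ha half_mem
  have hxm := mix_mem h.convex hx hm (α := α) ⟨hα.1.le, hα.2.le⟩
  have hs := mix_mem h.convex hb ha ht
  have e1 := h.indep _ hxm _ hs _ hm β hβ h1 h2
  have e2 := h.indep _ hs _ hxm _ hm β hβ h2 h1
  have hk : β * (α * u + (1 - α) * (1 / 2)) + (1 - β) * (1 / 2)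
      = β * α * u + (1 - β * α) * (1 / 2) := by ring
  rw [mix_mix_left, mix_mix_mix, hk] at e1 e2
  exact ⟨⟨mul_pos hβ.1 hα.1, by nlinarith [hβ.1, hβ.2, hα.1, hα.2]⟩,
    hk ▸ ⟨by nlinarith [ht.1, hβ.1, hβ.2], by nlinarith [ht.2, hβ.1, hβ.2]⟩, e1, e2⟩

theorem exists_isScaledValue (h : MixturePref C r) {b a x : V} (hb : b ∈ C) (ha : a ∈ C)
    (hab : ¬ r a b) (hx : x ∈ C) : ∃ u α, IsScaledValue r b a x u α := by
  have hm := mix_mem h.convex hb ha half_mem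
  have hU : ∀ᶠ α in nhdsWithin (0 : ℝ) (Set.Ioi 0),
      ¬ (α ∈ Set.Icc (0 : ℝ) 1 ∧ r (mix α x (mix (1 / 2) b a)) b) :=
    nhdsWithin_le_nhds ((h.closed_upper x hx _ hm b hb).isOpen_compl.mem_nhds (by
      rintro ⟨-, hr⟩
      rw [mix_zero] at hr
      exact h.not_mix_endpoint hb ha hab (by constructor <;> norm_num) hr))
  have hL : ∀ᶠ α in nhdsWithin (0 : ℝ) (Set.Ioi 0),
      ¬ (α ∈ Set.Icc (0 : ℝ) 1 ∧ r a (mix α x (mix (1 / 2) b a))) :=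
    nhdsWithin_le_nhds ((h.closed_lower x hx _ hm a ha).isOpen_compl.mem_nhds (by
      rintro ⟨-, hr⟩
      rw [mix_zero] at hr
      exact h.not_endpoint_mix hb ha hab (by constructor <;> norm_num) hr))
  have hI : ∀ᶠ α in nhdsWithin (0 : ℝ) (Set.Ioi 0), α ∈ Set.Ioo (0 : ℝ) 1 :=
    Ioo_mem_nhdsGT one_pos
  obtain ⟨α, h1, h2, hα⟩ := (hU.and (hL.and hI)).exists
  have hα' : α ∈ Set.Icc (0 : ℝ) 1 := ⟨hα.1.le, hα.2.le⟩
  have hxm := mix_mem h.convex hx hm hα'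
  have h1' := (h.total _ hxm _ hb).resolve_left fun hr => h1 ⟨hα', hr⟩
  have h2' := (h.total _ hxm _ ha).resolve_right fun hr => h2 ⟨hα', hr⟩
  obtain ⟨t, ht, e1, e2⟩ := h.exists_mix hb hxm ha h1' h2'
  have hk : α * ((t - (1 - α) * (1 / 2)) / α) + (1 - α) * (1 / 2) = t := by
    have := hα.1.ne'
    field_simp
    ring
  refine ⟨(t - (1 - α) * (1 / 2)) / α, α, hα, ?_⟩
  rw [hk]
  exact ⟨ht, e2, e1⟩

theorem IsScaledValue.rel_iff (h : MixturePref C r) {b a x y : V} (hb : b ∈ C) (ha : a ∈ C)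
    (hab : ¬ r a b) (hx : x ∈ C) (hy : y ∈ C) {u v α β : ℝ}
    (hG : IsScaledValue r b a x u α) (hG' : IsScaledValue r b a y v β) : r x y ↔ v ≤ u := by
  have hm := mix_mem h.convex hb ha half_mem
  obtain ⟨hγ, ht, h1, h2⟩ := IsScaledValue.mul h hb ha hx hG hG'.1
  obtain ⟨-, hs, k1, k2⟩ := mul_comm α β ▸ IsScaledValue.mul h hb ha hy hG' hG.1
  have hγ' : β * α ∈ Set.Icc (0 : ℝ) 1 := ⟨hγ.1.le, hγ.2.le⟩
  have hxm := mix_mem h.convex hx hm hγ'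
  have hym := mix_mem h.convex hy hm hγ'
  have htC := mix_mem h.convex hb ha ht
  have hsC := mix_mem h.convex hb ha hs
  rw [← h.mix_iff hx hy hm hγ]
  have key := h.mix_iff_le hb ha hab ht hs
  constructor
  · intro hr
    have := key.1 (h.trans _ htC _ hxm _ hsC h2 (h.trans _ hxm _ hym _ hsC hr k1))
    have : β * α * v ≤ β * α * u := by linarith
    exact le_of_mul_le_mul_left this hγ.1
  · intro hr
    have := key.2 (by nlinarith [mul_le_mul_of_nonneg_left hr hγ.1.le])
    exact h.trans _ hxm _ htC _ hym h1 (h.trans _ htC _ hsC _ hym this k2)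

theorem IsScaledValue.mix (h : MixturePref C r) {b a x y : V} (hb : b ∈ C) (ha : a ∈ C)
    (hx : x ∈ C) (hy : y ∈ C) {u v α β l : ℝ} (hl : l ∈ Set.Ioo (0 : ℝ) 1)
    (hG : IsScaledValue r b a x u α) (hG' : IsScaledValue r b a y v β) :
    IsScaledValue r b a (_root_.mix l x y) (l * u + (1 - l) * v) (β * α) := by
  have hm := mix_mem h.convex hb ha half_mem
  obtain ⟨hγ, ht, h1, h2⟩ := IsScaledValue.mul h hb ha hx hG hG'.1
  obtain ⟨-, hs, k1, k2⟩ := mul_comm α β ▸ IsScaledValue.mul h hb ha hy hG' hG.1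
  generalize β * α = γ at *
  have hγ' : γ ∈ Set.Icc (0 : ℝ) 1 := ⟨hγ.1.le, hγ.2.le⟩
  have hl' : l ∈ Set.Icc (0 : ℝ) 1 := ⟨hl.1.le, hl.2.le⟩
  have hl1 : 1 - l ∈ Set.Ioo (0 : ℝ) 1 := ⟨by linarith [hl.2], by linarith [hl.1]⟩
  have hxm := mix_mem h.convex hx hm hγ'
  have hym := mix_mem h.convex hy hm hγ'
  have htC := mix_mem h.convex hb ha ht
  have hsC := mix_mem h.convex hb ha hs
  have hk : l * (γ * u + (1 - γ) * (1 / 2)) + (1 - l) * (γ * v + (1 - γ) * (1 / 2))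
      = γ * (l * u + (1 - l) * v) + (1 - γ) * (1 / 2) := by ring
  have e1 := h.indep _ hxm _ htC _ hym l hl h1 h2
  have e2 := h.indep _ htC _ hxm _ hym l hl h2 h1
  have f1 := h.indep _ hym _ hsC _ htC _ hl1 k1 k2
  have f2 := h.indep _ hsC _ hym _ htC _ hl1 k2 k1
  rw [mix_swap, mix_swap] at f1 f2
  have c1 := mix_mem h.convex hxm hym hl'
  have c2 := mix_mem h.convex htC hym hl'
  have c3 := mix_mem h.convex htC hsC hl'
  have g1 := h.trans _ c1 _ c2 _ c3 e1 f1
  have g2 := h.trans _ c3 _ c2 _ c1 f2 e2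
  rw [mix_mix_mix, hk, ← mix_comm] at g1 g2
  refine ⟨hγ, ?_, g1, g2⟩
  rw [← hk]
  exact ⟨by nlinarith [ht.1, hs.1, hl.1, hl.2], by nlinarith [ht.2, hs.2, hl.1, hl.2]⟩

/-- The mixture space theorem, with utility normalised at two strictly ranked outcomes. -/
theorem exists_utility (h : MixturePref C r) {b a : V} (hb : b ∈ C) (ha : a ∈ C)
    (hab : ¬ r a b) :
    ∃ U : V → ℝ, (∀ x ∈ C, ∀ y ∈ C, ∀ l ∈ Set.Ioo (0 : ℝ) 1,
        U (mix l x y) = l * U x + (1 - l) * U y) ∧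
      (∀ x ∈ C, ∀ y ∈ C, (r x y ↔ U y ≤ U x)) ∧ U b = 1 ∧ U a = 0 := by
  have hex : ∀ x : V, ∃ u, x ∈ C → ∃ α, IsScaledValue r b a x u α := fun x => by
    by_cases hx : x ∈ C
    · obtain ⟨u, hu⟩ := h.exists_isScaledValue hb ha hab hx
      exact ⟨u, fun _ => hu⟩
    · exact ⟨0, fun h => absurd h hx⟩
  choose U hU using hex
  have huniq : ∀ x ∈ C, ∀ u α, IsScaledValue r b a x u α → U x = u := by
    intro x hx u α hG
    obtain ⟨β, hβ⟩ := hU x hx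
    exact le_antisymm ((IsScaledValue.rel_iff h hb ha hab hx hx hG hβ).1 (h.refl hx))
      ((IsScaledValue.rel_iff h hb ha hab hx hx hβ hG).1 (h.refl hx))
  have hm := mix_mem h.convex hb ha half_mem
  refine ⟨U, fun x hx y hy l hl => ?_, fun x hx y hy => ?_, huniq b hb 1 (1 / 2) ?_,
    huniq a ha 0 (1 / 2) ?_⟩
  · obtain ⟨α, hα⟩ := hU x hx
    obtain ⟨β, hβ⟩ := hU y hy
    exact huniq _ (mix_mem h.convex hx hy ⟨hl.1.le, hl.2.le⟩) _ _
      (IsScaledValue.mix h hb ha hx hy hl hα hβ)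
  · obtain ⟨α, hα⟩ := hU x hx
    obtain ⟨β, hβ⟩ := hU y hy
    exact IsScaledValue.rel_iff h hb ha hab hx hy hα hβ
  · have e : mix (1 / 2 : ℝ) b (mix (1 / 2) b a)
        = mix (1 / 2 * 1 + (1 - 1 / 2) * (1 / 2)) b a := by rw [mix_mix_right]; norm_num
    have := h.refl (mix_mem h.convex hb hm half_mem)
    refine ⟨by constructor <;> norm_num, by constructor <;> norm_num, ?_⟩
    rw [← e]
    exact ⟨this, this⟩
  · have e : mix (1 / 2 : ℝ) a (mix (1 / 2) b a)
        = mix (1 / 2 * 0 + (1 - 1 / 2) * (1 / 2)) b a := by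
      rw [← mix_swap, mix_mix_left]; norm_num
    have := h.refl (mix_mem h.convex ha hm half_mem)
    refine ⟨by constructor <;> norm_num, by constructor <;> norm_num, ?_⟩
    rw [← e]
    exact ⟨this, this⟩

end MixturePref

section Functional

variable {Ω : Type*} [Fintype Ω]

open Classical in
/-- A functional on `[0, 1]`-valued functions that is affine on antimonotonic pairs and vanishes
at zero is linear. -/
theorem eq_sum_of_antimonotonic_affine (I : (Ω → ℝ) → ℝ) (h0 : I 0 = 0)
    (hmix : ∀ f g : Ω → ℝ, (∀ ω, f ω ∈ Set.Icc (0 : ℝ) 1) → (∀ ω, g ω ∈ Set.Icc (0 : ℝ) 1) →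
      (∀ ω ω', f ω' < f ω → g ω' < g ω → False) → ∀ α ∈ Set.Ioo (0 : ℝ) 1,
      I (mix α f g) = α * I f + (1 - α) * I g)
    (f : Ω → ℝ) (hf : ∀ ω, f ω ∈ Set.Icc (0 : ℝ) 1) :
    I f = ∑ ω, I (Pi.single ω 1) * f ω := by
  have hscale : ∀ g : Ω → ℝ, (∀ ω, g ω ∈ Set.Icc (0 : ℝ) 1) → ∀ α ∈ Set.Icc (0 : ℝ) 1,
      I (α • g) = α * I g := by
    intro g hg α hα
    rcases hα.1.eq_or_lt with rfl | hα0
    · simp [h0]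
    rcases hα.2.eq_or_lt with rfl | hα1
    · simp
    · have := hmix g 0 hg (by simp) (by simp) α ⟨hα0, hα1⟩
      simpa [mix, h0] using this
  have hadd : ∀ g k : Ω → ℝ, (∀ ω, g ω ∈ Set.Icc (0 : ℝ) 1) →
      (∀ ω, k ω ∈ Set.Icc (0 : ℝ) 1) → (∀ ω, g ω + k ω ∈ Set.Icc (0 : ℝ) 1) →
      (∀ ω ω', g ω' < g ω → k ω' < k ω → False) → I (g + k) = I g + I k := by
    intro g k hg hk hgk hanti
    have e1 := hmix g k hg hk hanti (1 / 2) (by constructor <;> norm_num)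
    have e2 := hscale (g + k) hgk (1 / 2) MixturePref.half_mem
    have e3 : mix (1 / 2 : ℝ) g k = (1 / 2 : ℝ) • (g + k) := by unfold mix; module
    rw [e3, e2] at e1
    linarith
  have hind : ∀ s : Finset Ω, I (fun ω => if ω ∈ s then f ω else 0)
      = ∑ ω ∈ s, I (Pi.single ω 1) * f ω := by
    intro s
    induction s using Finset.induction_on with
    | empty => simpa [Pi.zero_def] using h0
    | insert a s ha ih =>
      have hsplit : (fun ω => if ω ∈ insert a s then f ω else 0)
          = f a • Pi.single a (1 : ℝ) + fun ω => if ω ∈ s then f ω else 0 := by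
        funext ω
        by_cases hω : ω = a
        · subst hω; simp [ha]
        · simp [hω]
      have hsingle : ∀ ω, (f a • Pi.single a (1 : ℝ) : Ω → ℝ) ω = if ω = a then f a else 0 := by
        intro ω
        by_cases hω : ω = a
        · subst hω; simp
        · simp [hω]
      have hmem : ∀ p : Prop, ∀ _ : Decidable p, ∀ ω,
          (if p then f ω else 0) ∈ Set.Icc (0 : ℝ) 1 := by
        intro p _ ω
        split_ifs
        · exact hf ω
        · simp
      rw [Finset.sum_insert ha, ← ih, hsplit, hadd, hscale _ _ _ (hf a), mul_comm]
      · intro ω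
        by_cases hω : ω = a
        · subst hω; simp
        · simp [hω]
      · intro ω; rw [hsingle]; exact hmem _ _ _
      · intro ω; exact hmem _ _ _
      · intro ω
        have := congrFun hsplit ω
        simp only [Pi.add_apply] at this
        rw [← this]; exact hmem _ _ _
      · intro ω ω' h1 h2
        rw [hsingle, hsingle] at h1
        by_cases hω : ω = a
        · subst hω
          have := (hmem (ω' ∈ s) inferInstance ω').1
          simp only [ha, if_false] at h2
          linarith
        · have := (hmem (ω' = a) inferInstance a).1
          simp only [hω, if_false] at h1
          linarith
  simpa using hind Finset.univ

end Functional

section Acts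

theorem IsAct.const {Ω V : Type*} {C : Set V} {x : V} (hx : x ∈ C) :
    IsAct C (Function.const Ω x) := fun _ => hx

variable {Ω : Type*} {V : Type*} [AddCommGroup V] [Module ℝ V] {C : Set V}
  {R : (Ω → V) → (Ω → V) → Prop}

theorem mix_const (α : ℝ) (x y : V) :
    mix α (Function.const Ω x) (Function.const Ω y) = Function.const Ω (mix α x y) := rfl

theorem IsAct.mix (hC : Convex ℝ C) {X Z : Ω → V} (hX : IsAct C X) (hZ : IsAct C Z) {α : ℝ}
    (hα : α ∈ Set.Icc (0 : ℝ) 1) : IsAct C (mix α X Z) :=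
  fun ω => mix_mem hC (hX ω) (hZ ω) hα

theorem convex_setOf_isAct (hC : Convex ℝ C) : Convex ℝ {X : Ω → V | IsAct C X} :=
  fun _ hX _ hY _ _ ha hb hab ω => hC (hX ω) (hY ω) ha hb hab

theorem mixturePref_const (hC : Convex ℝ C) (hW : WeakOrderActs C R)
    (hcont : MixtureContinuousActs C R) (hI : AmIndependence C R) :
    MixturePref C (fun x y => R (Function.const Ω x) (Function.const Ω y)) where
  convex := hC
  total _ hx _ hy := hW.1 _ _ (.const hx) (.const hy)
  trans _ hx _ hy _ hz := hW.2 _ _ _ (.const hx) (.const hy) (.const hz)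
  closed_upper _ hx _ hz _ hy := (hcont _ _ _ (.const hx) (.const hy) (.const hz)).1
  closed_lower _ hx _ hz _ hy := (hcont _ _ _ (.const hx) (.const hy) (.const hz)).2
  indep _ hx y hy _ hz α hα h1 h2 :=
    (hI _ _ (.const hx) (.const hz) (fun ⟨_, _, h, _⟩ => h.2 h.1) y hy α hα ⟨h1, h2⟩).1

/-- Mixing antimonotonic acts mixes their certainty equivalents. -/
theorem AmIndependence.mix (hC : Convex ℝ C) (hW : WeakOrderActs C R) (hI : AmIndependence C R)
    {X Z : Ω → V} (hX : IsAct C X) (hZ : IsAct C Z) (hXZ : AntimonotonicActs R X Z) {x z : V}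
    (hx : x ∈ C) (hz : z ∈ C) (hXx : R X (Function.const Ω x) ∧ R (Function.const Ω x) X)
    (hZz : R Z (Function.const Ω z) ∧ R (Function.const Ω z) Z) {α : ℝ}
    (hα : α ∈ Set.Ioo (0 : ℝ) 1) :
    R (_root_.mix α X Z) (Function.const Ω (_root_.mix α x z)) ∧
      R (Function.const Ω (_root_.mix α x z)) (_root_.mix α X Z) := by
  have e : R (_root_.mix α X Z) (_root_.mix α (Function.const Ω x) Z) ∧
      R (_root_.mix α (Function.const Ω x) Z) (_root_.mix α X Z) :=
    hI X Z hX hZ hXZ x hx α hα hXx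
  have f : R (_root_.mix (1 - α) Z (Function.const Ω x))
        (_root_.mix (1 - α) (Function.const Ω z) (Function.const Ω x)) ∧
      R (_root_.mix (1 - α) (Function.const Ω z) (Function.const Ω x))
        (_root_.mix (1 - α) Z (Function.const Ω x)) :=
    hI Z (Function.const Ω x) hZ (.const hx) (fun ⟨_, _, _, h⟩ => h.2 h.1) z hz (1 - α)
      ⟨by linarith [hα.2], by linarith [hα.1]⟩ hZz
  rw [mix_swap, mix_swap, mix_const] at f
  have hα' : α ∈ Set.Icc (0 : ℝ) 1 := ⟨hα.1.le, hα.2.le⟩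
  have c1 := hX.mix hC hZ hα'
  have c2 := (IsAct.const (Ω := Ω) hx).mix hC hZ hα'
  have c3 := IsAct.const (Ω := Ω) (mix_mem hC hx hz hα')
  exact ⟨hW.2 _ _ _ c1 c2 c3 e.1 f.1, hW.2 _ _ _ c3 c2 c1 f.2 e.2⟩

theorem exists_certaintyEquivalent [Finite Ω] [Nonempty Ω] (hC : Convex ℝ C)
    (hW : WeakOrderActs C R) (hM : MonotoneActs C R) (hcont : MixtureContinuousActs C R)
    {U : V → ℝ} (hU : ∀ x ∈ C, ∀ y ∈ C,
      (R (Function.const Ω x) (Function.const Ω y) ↔ U y ≤ U x))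
    {X : Ω → V} (hX : IsAct C X) :
    ∃ x ∈ C, R X (Function.const Ω x) ∧ R (Function.const Ω x) X := by
  obtain ⟨i, hi⟩ := Finite.exists_max fun ω => U (X ω)
  obtain ⟨j, hj⟩ := Finite.exists_min fun ω => U (X ω)
  have ci : IsAct C (Function.const Ω (X i)) := .const (hX i)
  have cj : IsAct C (Function.const Ω (X j)) := .const (hX j)
  have h1 := hM _ X ci hX fun ω => (hU _ (hX i) _ (hX ω)).2 (hi ω)
  have h2 := hM X _ hX cj fun ω => (hU _ (hX ω) _ (hX j)).2 (hj ω)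
  obtain ⟨α, hα, e1, e2⟩ := exists_mix_indiff (convex_setOf_isAct hC)
    (fun X hX Y hY => hW.1 X Y hX hY) ci hX cj (hcont _ _ _ ci hX cj).1
    (hcont _ _ _ ci hX cj).2 h1 h2
  exact ⟨_, mix_mem hC (hX i) (hX j) hα, e2, e1⟩

open Classical in
theorem seuRepresentation_of_amIndependence [Fintype Ω] [Nonempty Ω] (hC : Convex ℝ C)
    (hW : WeakOrderActs C R) (hM : MonotoneActs C R) (hcont : MixtureContinuousActs C R)
    (hI : AmIndependence C R) : SEURepresentation C R := by
  by_cases htriv : ∀ x ∈ C, ∀ y ∈ C, R (Function.const Ω x) (Function.const Ω y)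
  · obtain ⟨ω₀⟩ := ‹Nonempty Ω›
    refine ⟨Pi.single ω₀ 1, fun ω => ?_, by simp, 0, by simp, fun X Y hX hY => ?_⟩
    · by_cases hω : ω = ω₀
      · subst hω; simp
      · simp [hω]
    · simpa using hM X Y hX hY fun ω => htriv _ (hX ω) _ (hY ω)
  push Not at htriv
  obtain ⟨a, ha, b, hb, hab⟩ := htriv
  have hP := mixturePref_const hC hW hcont hI
  obtain ⟨U, haff, hU, hUb, hUa⟩ := hP.exists_utility hb ha hab
  have hce : ∀ X : Ω → V, ∃ x, IsAct C X →
      x ∈ C ∧ R X (Function.const Ω x) ∧ R (Function.const Ω x) X := fun X => by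
    by_cases hX : IsAct C X
    · obtain ⟨x, hx⟩ := exists_certaintyEquivalent hC hW hM hcont hU hX
      exact ⟨x, fun _ => hx⟩
    · exact ⟨0, fun h => absurd h hX⟩
  choose ce hce using hce
  have hrep : ∀ X Y, IsAct C X → IsAct C Y → (R X Y ↔ U (ce Y) ≤ U (ce X)) := by
    intro X Y hX hY
    obtain ⟨x, x1, x2⟩ := hce X hX
    obtain ⟨y, y1, y2⟩ := hce Y hY
    rw [← hU _ x _ y]
    have cx : IsAct C (Function.const Ω (ce X)) := .const x
    have cy : IsAct C (Function.const Ω (ce Y)) := .const y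
    exact ⟨fun h => hW.2 _ _ _ cx hX cy x2 (hW.2 _ _ _ hX hY cy h y1),
      fun h => hW.2 _ _ _ hX cx hY x1 (hW.2 _ _ _ cx cy hY h y2)⟩
  have hval : ∀ X, IsAct C X → ∀ x ∈ C,
      R X (Function.const Ω x) ∧ R (Function.const Ω x) X → U (ce X) = U x := by
    intro X hX x hx h
    obtain ⟨y, y1, y2⟩ := hce X hX
    have cx : IsAct C (Function.const Ω x) := .const hx
    have cy : IsAct C (Function.const Ω (ce X)) := .const y
    exact le_antisymm ((hU _ hx _ y).1 (hW.2 _ _ _ cx hX cy h.2 y1))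
      ((hU _ y _ hx).1 (hW.2 _ _ _ cy hX cx y2 h.1))
  have hconst : ∀ x ∈ C, U (ce (Function.const Ω x)) = U x := fun x hx =>
    hval _ (.const hx) x hx ⟨hP.refl hx, hP.refl hx⟩
  have hmono : ∀ X Y, IsAct C X → IsAct C Y → (∀ ω, U (Y ω) ≤ U (X ω)) →
      U (ce Y) ≤ U (ce X) := fun X Y hX hY h =>
    (hrep X Y hX hY).1 (hM X Y hX hY fun ω => (hU _ (hX ω) _ (hY ω)).2 (h ω))
  have hmix : ∀ X Z, IsAct C X → IsAct C Z →
      (∀ ω ω', U (X ω') < U (X ω) → U (Z ω') < U (Z ω) → False) → ∀ α ∈ Set.Ioo (0 : ℝ) 1,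
      U (ce (mix α X Z)) = α * U (ce X) + (1 - α) * U (ce Z) := by
    intro X Z hX hZ hXZ α hα
    obtain ⟨x, hx⟩ := hce X hX
    obtain ⟨z, hz⟩ := hce Z hZ
    have hanti : AntimonotonicActs R X Z := by
      rintro ⟨ω, ω', h1, h2⟩
      refine hXZ ω ω' (not_le.1 fun h => h1.2 ?_) (not_le.1 fun h => h2.2 ?_)
      · exact (hU _ (hX ω') _ (hX ω)).2 h
      · exact (hU _ (hZ ω') _ (hZ ω)).2 h
    have hα' : α ∈ Set.Icc (0 : ℝ) 1 := ⟨hα.1.le, hα.2.le⟩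
    rw [hval _ (hX.mix hC hZ hα') _ (mix_mem hC x z hα')
      (AmIndependence.mix hC hW hI hX hZ hanti x z hx hz hα), haff _ x _ z α hα]
  have hUseg : ∀ t ∈ Set.Icc (0 : ℝ) 1, U (mix t b a) = t := by
    intro t ht
    rcases ht.1.eq_or_lt with rfl | h0
    · simpa using hUa
    rcases ht.2.eq_or_lt with rfl | h1
    · simpa using hUb
    · rw [haff b hb a ha t ⟨h0, h1⟩, hUa, hUb]; ring
  obtain ⟨emb, hemb⟩ : ∃ emb : (Ω → ℝ) → Ω → V, ∀ f, emb f = fun ω => mix (f ω) b a :=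
    ⟨_, fun _ => rfl⟩
  have hembAct : ∀ f : Ω → ℝ, (∀ ω, f ω ∈ Set.Icc (0 : ℝ) 1) → IsAct C (emb f) :=
    fun f hf ω => by rw [hemb]; exact mix_mem hC hb ha (hf ω)
  have hembU : ∀ f : Ω → ℝ, (∀ ω, f ω ∈ Set.Icc (0 : ℝ) 1) → ∀ ω, U (emb f ω) = f ω :=
    fun f hf ω => by rw [hemb]; exact hUseg _ (hf ω)
  have hembMix : ∀ (α : ℝ) (f g : Ω → ℝ), emb (mix α f g) = mix α (emb f) (emb g) := by
    intro α f g
    funext ω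
    simp only [hemb, mix, Pi.add_apply, Pi.smul_apply, smul_eq_mul]
    module
  have hemb0 : emb 0 = Function.const Ω a := by
    rw [hemb]; funext ω; simp
  have hlin := eq_sum_of_antimonotonic_affine (fun f => U (ce (emb f)))
    (by rw [hemb0, hconst a ha, hUa])
    (fun f g hf hg hfg α hα => by
      rw [hembMix]
      refine hmix _ _ (hembAct f hf) (hembAct g hg) (fun ω ω' h1 h2 => hfg ω ω' ?_ ?_) α hα
      · simpa only [hembU f hf] using h1
      · simpa only [hembU g hg] using h2)
  obtain ⟨p, hp⟩ : ∃ p : Ω → ℝ, ∀ ω, p ω = U (ce (emb (Pi.single ω 1))) := ⟨_, fun _ => rfl⟩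
  simp only [← hp] at hlin
  have hp0 : ∀ ω, 0 ≤ p ω := by
    intro ω
    have hs : ∀ ω', (Pi.single ω (1 : ℝ) : Ω → ℝ) ω' ∈ Set.Icc (0 : ℝ) 1 := by
      intro ω'
      by_cases h : ω' = ω
      · subst h; simp
      · simp [h]
    have := hmono _ _ (hembAct _ hs) (.const ha) fun ω' => by
      rw [hembU _ hs, Function.const_apply, hUa]; exact (hs ω').1
    rwa [hconst a ha, hUa, ← hp] at this
  have hp1 : ∑ ω, p ω = 1 := by
    have := hlin (fun _ => 1) (by simp)
    have e : emb (fun _ => 1) = Function.const Ω b := by rw [hemb]; funext ω; simp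
    rw [e, hconst b hb, hUb] at this
    simpa using this.symm
  have hJ : ∀ X, IsAct C X → U (ce X) = ∑ ω, p ω * U (X ω) := by
    intro X hX
    obtain ⟨S, hS⟩ : ∃ S, S = ∑ ω, |U (X ω) - 1 / 2| := ⟨_, rfl⟩
    have hle : ∀ ω, |U (X ω) - 1 / 2| ≤ S := fun ω => by
      rw [hS]
      exact Finset.single_le_sum (f := fun ω => |U (X ω) - 1 / 2|) (fun _ _ => abs_nonneg _)
        (Finset.mem_univ ω)
    have hS0 : 0 ≤ S := by rw [hS]; exact Finset.sum_nonneg fun _ _ => abs_nonneg _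
    obtain ⟨α, hα⟩ : ∃ α, α = 1 / (2 * (1 + S)) := ⟨_, rfl⟩
    have hα0 : 0 < α := by rw [hα]; positivity
    have hαS : α * (1 + S) = 1 / 2 := by rw [hα]; field_simp
    have hα1 : α < 1 := by nlinarith
    have hm := mix_mem hC hb ha MixturePref.half_mem
    have hUm := hUseg _ MixturePref.half_mem
    have hcm : IsAct C (Function.const Ω (mix (1 / 2 : ℝ) b a)) := .const hm
    have e1 := hmix X _ hX hcm (fun _ _ _ h => lt_irrefl _ h) α ⟨hα0, hα1⟩
    rw [hconst _ hm, hUm] at e1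
    have hXm := hX.mix hC hcm (α := α) ⟨hα0.le, hα1.le⟩
    have hf : ∀ ω, α * U (X ω) + (1 - α) * (1 / 2) ∈ Set.Icc (0 : ℝ) 1 := by
      intro ω
      have := abs_le.1 (hle ω)
      constructor <;> nlinarith
    have hUmix : ∀ ω, U (mix α X (Function.const Ω (mix (1 / 2 : ℝ) b a)) ω)
        = α * U (X ω) + (1 - α) * (1 / 2) := by
      intro ω
      have := haff _ (hX ω) _ hm α ⟨hα0, hα1⟩
      rwa [hUm] at this
    have e2 := hlin _ hf
    have e3 := le_antisymm
      (hmono _ _ (hembAct _ hf) hXm fun ω => by rw [hUmix, hembU _ hf])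
      (hmono _ _ hXm (hembAct _ hf) fun ω => by rw [hUmix, hembU _ hf])
    have e4 : ∑ ω, p ω * (α * U (X ω) + (1 - α) * (1 / 2))
        = α * ∑ ω, p ω * U (X ω) + (1 - α) * (1 / 2) * ∑ ω, p ω := by
      rw [Finset.mul_sum, Finset.mul_sum, ← Finset.sum_add_distrib]
      exact Finset.sum_congr rfl fun ω _ => by ring
    rw [hp1] at e4
    have : α * U (ce X) = α * ∑ ω, p ω * U (X ω) := by linarith
    exact mul_left_cancel₀ hα0.ne' this
  refine ⟨p, hp0, hp1, U, haff, fun X Y hX hY => ?_⟩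
  rw [hrep X Y hX hY, hJ X hX, hJ Y hY]

theorem StrongIndependence.amIndependence (h : StrongIndependence C R) : AmIndependence C R :=
  fun X Z hX hZ _ => h X Z hX hZ

theorem SEURepresentation.preference_conditions [Fintype Ω] (hC : Convex ℝ C)
    (h : SEURepresentation C R) :
    WeakOrderActs C R ∧ MonotoneActs C R ∧ MixtureContinuousActs C R ∧
      StrongIndependence C R := by
  obtain ⟨p, hp0, hp1, U, haff, hrep⟩ := h
  have hconst : ∀ x : V, ∑ ω, p ω * U (Function.const Ω x ω) = U x := fun x => by
    simp [← Finset.sum_mul, hp1]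
  have hmix : ∀ X Z, IsAct C X → IsAct C Z → ∀ α ∈ Set.Icc (0 : ℝ) 1,
      ∑ ω, p ω * U (mix α X Z ω)
        = α * ∑ ω, p ω * U (X ω) + (1 - α) * ∑ ω, p ω * U (Z ω) := by
    intro X Z hX hZ α hα
    rcases hα.1.eq_or_lt with rfl | h0
    · simp
    rcases hα.2.eq_or_lt with rfl | h1
    · simp
    rw [Finset.mul_sum, Finset.mul_sum, ← Finset.sum_add_distrib]
    refine Finset.sum_congr rfl fun ω _ => ?_
    have : U (mix α X Z ω) = α * U (X ω) + (1 - α) * U (Z ω) :=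
      haff _ (hX ω) _ (hZ ω) α ⟨h0, h1⟩
    rw [this]; ring
  refine ⟨⟨fun X Y hX hY => ?_, fun X Y Z hX hY hZ hXY hYZ => ?_⟩, fun X Y hX hY hXY => ?_,
    fun X Y Z hX hY hZ => ⟨?_, ?_⟩, fun X Z hX hZ x hx α hα hXx => ?_⟩
  · rw [hrep X Y hX hY, hrep Y X hY hX]
    exact le_total _ _
  · rw [hrep X Y hX hY] at hXY
    rw [hrep Y Z hY hZ] at hYZ
    exact (hrep X Z hX hZ).2 (hYZ.trans hXY)
  · refine (hrep X Y hX hY).2 (Finset.sum_le_sum fun ω _ =>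
      mul_le_mul_of_nonneg_left ?_ (hp0 ω))
    have := (hrep _ _ (.const (hX ω)) (.const (hY ω))).1 (hXY ω)
    rwa [hconst, hconst] at this
  · have : {α : ℝ | α ∈ Set.Icc (0 : ℝ) 1 ∧ R (α • X + (1 - α) • Z) Y}
        = Set.Icc 0 1 ∩ {α : ℝ | ∑ ω, p ω * U (Y ω)
          ≤ α * ∑ ω, p ω * U (X ω) + (1 - α) * ∑ ω, p ω * U (Z ω)} := by
      ext α
      refine and_congr_right fun hα => ?_
      rw [Set.mem_ofPred_eq, ← hmix X Z hX hZ α hα]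
      exact hrep _ _ (hX.mix hC hZ hα) hY
    rw [this]
    exact isClosed_Icc.inter (isClosed_le (by fun_prop) (by fun_prop))
  · have : {α : ℝ | α ∈ Set.Icc (0 : ℝ) 1 ∧ R Y (α • X + (1 - α) • Z)}
        = Set.Icc 0 1 ∩ {α : ℝ | α * ∑ ω, p ω * U (X ω) + (1 - α) * ∑ ω, p ω * U (Z ω)
          ≤ ∑ ω, p ω * U (Y ω)} := by
      ext α
      refine and_congr_right fun hα => ?_
      rw [Set.mem_ofPred_eq, ← hmix X Z hX hZ α hα]
      exact hrep _ _ hY (hX.mix hC hZ hα)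
    rw [this]
    exact isClosed_Icc.inter (isClosed_le (by fun_prop) (by fun_prop))
  · have hα' : α ∈ Set.Icc (0 : ℝ) 1 := ⟨hα.1.le, hα.2.le⟩
    have cx : IsAct C (Function.const Ω x) := .const hx
    have e := le_antisymm ((hrep _ _ hX cx).1 hXx.1) ((hrep _ _ cx hX).1 hXx.2)
    have e' : ∑ ω, p ω * U (mix α X Z ω) = ∑ ω, p ω * U (mix α (Function.const Ω x) Z ω) := by
      rw [hmix X Z hX hZ α hα', hmix _ Z cx hZ α hα', e]
    have c1 := hX.mix hC hZ hα'
    have c2 := cx.mix hC hZ hα'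
    exact ⟨(hrep _ _ c1 c2).2 e'.ge, (hrep _ _ c2 c1).2 e'.le⟩

end Acts

/-- Anscombe–Aumann expected utility with independence weakened to
antimonotonic acts: the three statements are equivalent. -/
theorem am_anscombe_aumann {Ω : Type*} [Fintype Ω] [Nonempty Ω]
    {V : Type*} [AddCommGroup V] [Module ℝ V]
    (C : Set V) (hconv : Convex ℝ C) (hne : C.Nonempty)
    (R : (Ω → V) → (Ω → V) → Prop) :
    ((WeakOrderActs C R ∧ MonotoneActs C R ∧ MixtureContinuousActs C R ∧
        StrongIndependence C R) ↔
      (WeakOrderActs C R ∧ MonotoneActs C R ∧ MixtureContinuousActs C R ∧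
        AmIndependence C R)) ∧
    ((WeakOrderActs C R ∧ MonotoneActs C R ∧ MixtureContinuousActs C R ∧
        AmIndependence C R) ↔
      SEURepresentation C R) := by
  have back : SEURepresentation C R → _ := SEURepresentation.preference_conditions hconv
  have forth : (WeakOrderActs C R ∧ MonotoneActs C R ∧ MixtureContinuousActs C R ∧
      AmIndependence C R) → SEURepresentation C R := fun ⟨hW, hM, hcont, hI⟩ =>
    seuRepresentation_of_amIndependence hconv hW hM hcont hI
  have weaken : (WeakOrderActs C R ∧ MonotoneActs C R ∧ MixtureContinuousActs C R ∧
      StrongIndependence C R) → _ := fun ⟨hW, hM, hcont, hI⟩ =>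
    (⟨hW, hM, hcont, hI.amIndependence⟩ : WeakOrderActs C R ∧ MonotoneActs C R ∧
      MixtureContinuousActs C R ∧ AmIndependence C R)
  exact ⟨⟨weaken, fun h => back (forth h)⟩, ⟨forth, fun h => weaken (back h)⟩⟩
end
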